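/- arXiv:1901.04296 — 12 statements merged into one kernel-verified Lean document; each statement's English description precedes it below -/
import Mathlib

section
/- There exists a unique holomorphic function s on the open disc B_r(0) of radius r = 2^(-2/3) about 0 in the complex plane such that s(0) = 0 and, for every z in B_r(0), s'(z) = (1 - s(z)^3)^(2/3) where the power is principal-valued; moreover this s takes all its values in the open unit disc. -/
open Complex Metric Set

/-- On `|θ| < π / 2` one has `(cos θ) ^ (2 / 3) ≤ cos (2 θ / 3)`. -/
lemma cos_rpow_two_thirds_le {θ : ℝ} (hθ : |θ| < Real.pi / 2) :
    Real.cos θ ^ (2 / 3 : ℝ) ≤ Real.cos (θ * (2 / 3)) := by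
  obtain ⟨h₁, h₂⟩ := abs_lt.mp hθ
  set c := Real.cos (θ / 3) with hc
  have hθ3 : Real.cos θ = 4 * c ^ 3 - 3 * c := by
    rw [hc, ← Real.cos_three_mul]; congr 1; ring
  have hθ2 : Real.cos (θ * (2 / 3)) = 2 * c ^ 2 - 1 := by
    rw [hc, ← Real.cos_two_mul]; congr 1; ring
  have hpos : 0 < Real.cos θ := Real.cos_pos_of_mem_Ioo ⟨h₁, h₂⟩
  have hc0 : 0 < c := Real.cos_pos_of_mem_Ioo ⟨by linarith, by linarith⟩
  have hc1 : c ≤ 1 := Real.cos_le_one _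
  have hc2 : 3 / 4 ≤ c ^ 2 := by
    rw [hθ3] at hpos
    nlinarith
  have hc3 : c ^ 2 ≤ 1 := by nlinarith
  have key : Real.cos θ ^ 2 ≤ (2 * c ^ 2 - 1) ^ 3 := by
    rw [hθ3]
    have : 0 ≤ (1 - c ^ 2) * (8 * (c ^ 2) ^ 2 - 4 * c ^ 2 - 1) :=
      mul_nonneg (by linarith) (by nlinarith)
    nlinarith
  rw [hθ2]
  calc Real.cos θ ^ (2 / 3 : ℝ) = (Real.cos θ ^ 2) ^ (1 / 3 : ℝ) := by
        rw [← Real.rpow_natCast, ← Real.rpow_mul hpos.le]; norm_num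
    _ ≤ ((2 * c ^ 2 - 1) ^ 3) ^ (1 / 3 : ℝ) :=
        Real.rpow_le_rpow (by positivity) key (by norm_num)
    _ = 2 * c ^ 2 - 1 := by
        rw [← Real.rpow_natCast, ← Real.rpow_mul (by linarith)]; norm_num

lemma Complex.norm_sq_lt_two_mul_re {u : ℂ} (hu : ‖1 - u‖ < 1) : ‖u‖ ^ 2 < 2 * u.re := by
  have h : ‖1 - u‖ ^ 2 < 1 := by nlinarith [norm_nonneg (1 - u)]
  rw [← Complex.normSq_eq_norm_sq, Complex.normSq_apply] at h ⊢
  simp only [sub_re, one_re, sub_im, one_im] at h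
  nlinarith

lemma Complex.re_pos_of_norm_one_sub_lt {u : ℂ} (hu : ‖1 - u‖ < 1) : 0 < u.re := by
  nlinarith [norm_sq_lt_two_mul_re hu, sq_nonneg ‖u‖]

/-- Inversion maps the disc `|1 - u| < 1` to the half plane `re > 1 / 2`; this is the analogue
for the power `-2 / 3`. -/
lemma Complex.le_re_inv_cpow_two_thirds {u : ℂ} (hu : ‖1 - u‖ < 1) :
    (2 : ℝ) ^ (-(2 / 3) : ℝ) ≤ ((u ^ ((2 : ℂ) / 3))⁻¹).re := by
  have hre := re_pos_of_norm_one_sub_lt hu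
  have hu0 : u ≠ 0 := by rintro rfl; simp at hre
  have hn : 0 < ‖u‖ := norm_pos_iff.mpr hu0
  have harg : |arg u| < Real.pi / 2 := abs_arg_lt_pi_div_two_iff.mpr (Or.inl hre)
  have hcast : (u ^ ((2 : ℂ) / 3))⁻¹ = u ^ ((-(2 / 3) : ℝ) : ℂ) := by
    rw [← cpow_neg]; congr 1; push_cast; ring
  have hcos : ‖u‖ / 2 ≤ Real.cos (arg u) := by
    rw [cos_arg hu0, le_div_iff₀ hn]
    nlinarith [norm_sq_lt_two_mul_re hu]
  have h : (‖u‖ / 2) ^ (2 / 3 : ℝ) ≤ Real.cos (arg u * (2 / 3)) :=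
    (Real.rpow_le_rpow (by positivity) hcos (by norm_num)).trans (cos_rpow_two_thirds_le harg)
  rw [hcast, cpow_ofReal_re, mul_neg, Real.cos_neg]
  calc (2 : ℝ) ^ (-(2 / 3) : ℝ) = ‖u‖ ^ (-(2 / 3) : ℝ) * (‖u‖ / 2) ^ (2 / 3 : ℝ) := by
        rw [Real.div_rpow hn.le zero_le_two, Real.rpow_neg hn.le, Real.rpow_neg zero_le_two]
        have := Real.rpow_pos_of_pos hn (2 / 3)
        field_simp
    _ ≤ _ := by gcongr

/-- A quantitative Noshiro–Warschawski inequality: if `re G' ≥ m` on a convex set, then `G`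
expands distances by at least the factor `m`. -/
lemma Convex.mul_norm_sub_le_of_le_re_deriv {U : Set ℂ} (hU : Convex ℝ U) {G G' : ℂ → ℂ} {m : ℝ}
    (hG : ∀ w ∈ U, HasDerivAt G (G' w) w) (hm : ∀ w ∈ U, m ≤ (G' w).re) {a b : ℂ}
    (ha : a ∈ U) (hb : b ∈ U) : m * ‖b - a‖ ≤ ‖G b - G a‖ := by
  rcases eq_or_ne b a with rfl | hab
  · simp
  have hseg : ∀ x ∈ Icc (0 : ℝ) 1, a + x * (b - a) ∈ U := fun x hx => by
    simpa using hU.add_smul_sub_mem ha hb hx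
  have hd : ∀ x ∈ Icc (0 : ℝ) 1, HasDerivAt
      (fun x : ℝ => (starRingEnd ℂ (b - a) * G (a + x * (b - a))).re)
      (starRingEnd ℂ (b - a) * (G' (a + x * (b - a)) * (b - a))).re x := fun x hx => by
    have hline : HasDerivAt (fun y : ℂ => a + y * (b - a)) (b - a) (x : ℂ) := by
      simpa using ((hasDerivAt_id (x : ℂ)).mul_const (b - a)).const_add a
    exact (((hG _ (hseg x hx)).comp (x : ℂ) hline).const_mul _).real_of_complex
  obtain ⟨c, hc, hslope⟩ := exists_hasDerivAt_eq_slope _ _ zero_lt_one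
    (fun x hx => (hd x hx).continuousAt.continuousWithinAt)
    (fun x hx => hd x (Ioo_subset_Icc_self hx))
  have hc' := hm _ (hseg c (Ioo_subset_Icc_self hc))
  have hpos : 0 < ‖b - a‖ := norm_pos_iff.mpr (sub_ne_zero.mpr hab)
  have hlhs : (starRingEnd ℂ (b - a) * (G' (a + c * (b - a)) * (b - a))).re
      = ‖b - a‖ ^ 2 * (G' (a + c * (b - a))).re := by
    rw [mul_left_comm, mul_comm, mul_comm (starRingEnd ℂ (b - a)), mul_conj, re_ofReal_mul,
      normSq_eq_norm_sq]
  have hrhs : (starRingEnd ℂ (b - a) * (G b - G a)).re ≤ ‖b - a‖ * ‖G b - G a‖ :=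
    (re_le_norm _).trans (by rw [norm_mul, norm_conj])
  have hle : ‖b - a‖ * (m * ‖b - a‖) ≤ ‖b - a‖ * ‖G b - G a‖ := by
    refine le_trans ?_ hrhs
    have : (starRingEnd ℂ (b - a) * (G b - G a)).re
        = ‖b - a‖ ^ 2 * (G' (a + c * (b - a))).re := by
      rw [← hlhs, hslope, mul_sub, sub_re]; simp
    rw [this]
    nlinarith [mul_le_mul_of_nonneg_left hc' (sq_nonneg ‖b - a‖)]
  exact le_of_mul_le_mul_left hle hpos

/-- An expanding local homeomorphism of a disc covers the disc expanded accordingly. -/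
lemma ball_subset_image_ball_of_expanding {G G' : ℂ → ℂ} {c : ℂ} {R m : ℝ} (hR : 0 < R)
    (hm : 0 < m) (hG : ∀ w ∈ ball c R, HasDerivAt G (G' w) w) (hG' : ∀ w ∈ ball c R, G' w ≠ 0)
    (hexp : ∀ w ∈ ball c R, m * ‖w - c‖ ≤ ‖G w - G c‖) :
    ball (G c) (m * R) ⊆ G '' ball c R := by
  have hdiff : DifferentiableOn ℂ G (ball c R) := fun w hw =>
    (hG w hw).differentiableAt.differentiableWithinAt
  have hopen : IsOpen (G '' ball c R) := by
    refine isOpen_iff_mem_nhds.mpr ?_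
    rintro _ ⟨w, hw, rfl⟩
    have hs : HasStrictDerivAt G (G' w) w := by
      have := (hdiff.analyticAt (isOpen_ball.mem_nhds hw)).hasStrictDerivAt
      rwa [(hG w hw).deriv] at this
    rw [← hs.map_nhds_eq (hG' w hw)]
    exact Filter.image_mem_map (isOpen_ball.mem_nhds hw)
  refine (convex_ball _ _).isPreconnected.subset_of_closure_inter_subset hopen
    ⟨G c, mem_ball_self (by positivity), mem_image_of_mem _ (mem_ball_self hR)⟩ ?_
  rintro z ⟨hzc, hz⟩
  obtain ⟨q, hq, hqR⟩ := exists_between (mem_ball.mp hz)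
  have hsub : closedBall c (q / m) ⊆ ball c R :=
    closedBall_subset_ball ((div_lt_iff₀' hm).mpr hqR)
  have hcpt : IsCompact (G '' closedBall c (q / m)) :=
    (isCompact_closedBall _ _).image_of_continuousOn (hdiff.continuousOn.mono hsub)
  have hz' : z ∈ closure (ball (G c) q ∩ G '' ball c R) :=
    isOpen_ball.inter_closure ⟨mem_ball.mpr hq, hzc⟩
  refine image_mono hsub (closure_minimal ?_ hcpt.isClosed hz')
  rintro _ ⟨hv, w, hw, rfl⟩
  refine mem_image_of_mem _ ?_
  rw [mem_ball, dist_eq_norm] at hv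
  rw [mem_closedBall, dist_eq_norm, le_div_iff₀' hm]
  exact (hexp w hw).trans hv.le

lemma Complex.norm_one_sub_one_sub_cube_lt {w : ℂ} (hw : w ∈ ball (0 : ℂ) 1) :
    ‖1 - (1 - w ^ 3)‖ < 1 := by
  rw [mem_ball_zero_iff] at hw
  simpa using pow_lt_one₀ (norm_nonneg w) hw three_ne_zero

/-- There exists a unique holomorphic function `s` on the open disc
`B_r(0)`, `r = 2^(-2/3)`, with `s 0 = 0` and `s' z = (1 - s z ^ 3) ^ (2/3)`
(principal-valued power); moreover this `s` takes its values in the open unit disc. -/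
theorem dixon_initial_existence_uniqueness (r : ℝ) (hr : r = (2:ℝ) ^ (-(2/3) : ℝ)) :
    ∃ s : ℂ → ℂ,
      ((s 0 = 0 ∧
          ∀ z ∈ Metric.ball (0:ℂ) r, HasDerivAt s ((1 - s z ^ 3) ^ ((2:ℂ)/3)) z) ∧
        ∀ z ∈ Metric.ball (0:ℂ) r, s z ∈ Metric.ball (0:ℂ) 1) ∧
      ∀ t : ℂ → ℂ,
        (t 0 = 0 ∧
          ∀ z ∈ Metric.ball (0:ℂ) r, HasDerivAt t ((1 - t z ^ 3) ^ ((2:ℂ)/3)) z) →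
        Set.EqOn t s (Metric.ball (0:ℂ) r) := by
  have hr0 : 0 < r := hr ▸ Real.rpow_pos_of_pos two_pos _
  set F : ℂ → ℂ := fun w => (1 - w ^ 3) ^ ((2 : ℂ) / 3)
  have hre : ∀ w ∈ ball (0 : ℂ) 1, r ≤ ((F w)⁻¹).re := fun w hw =>
    hr ▸ le_re_inv_cpow_two_thirds (norm_one_sub_one_sub_cube_lt hw)
  have hF' : ∀ w ∈ ball (0 : ℂ) 1, (F w)⁻¹ ≠ 0 := fun w hw h => by
    have := hre w hw
    rw [h, zero_re] at this
    linarith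
  have hF0 : ∀ w ∈ ball (0 : ℂ) 1, F w ≠ 0 := fun w hw h => hF' w hw (by rw [h, inv_zero])
  have hFdiff : DifferentiableOn ℂ (fun w => (F w)⁻¹) (ball 0 1) := fun w hw => by
    have hslit : 1 - w ^ 3 ∈ slitPlane :=
      Or.inl (re_pos_of_norm_one_sub_lt (norm_one_sub_one_sub_cube_lt hw))
    have hd : DifferentiableAt ℂ (fun w : ℂ => 1 - w ^ 3) w := by fun_prop
    exact ((hd.cpow_const hslit).inv (hF0 w hw)).differentiableWithinAt
  obtain ⟨G, hG0, hG⟩ := hFdiff.isExactOn_ball.with_val_at 0 0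
  have hexp : ∀ a ∈ ball (0 : ℂ) 1, ∀ b ∈ ball (0 : ℂ) 1, r * ‖b - a‖ ≤ ‖G b - G a‖ :=
    fun a ha b hb => (convex_ball _ _).mul_norm_sub_le_of_le_re_deriv hG hre ha hb
  have h0 : (0 : ℂ) ∈ ball (0 : ℂ) 1 := mem_ball_self one_pos
  have hinj : InjOn G (ball 0 1) := fun a ha b hb hab => by
    have := hexp b hb a ha
    rw [hab, sub_self, norm_zero] at this
    have h : ‖a - b‖ ≤ 0 := by nlinarith
    exact sub_eq_zero.mp (norm_le_zero_iff.mp h)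
  have hsurj : ∀ z ∈ ball (0 : ℂ) r, ∃ w ∈ ball (0 : ℂ) 1, G w = z := by
    have := ball_subset_image_ball_of_expanding one_pos hr0 hG hF' fun w hw => hexp 0 h0 w hw
    rwa [hG0, mul_one] at this
  choose! s hs1 hGs using hsurj
  have hr0mem : (0 : ℂ) ∈ ball (0 : ℂ) r := mem_ball_self hr0
  have hs0 : s 0 = 0 := hinj (hs1 _ hr0mem) h0 ((hGs _ hr0mem).trans hG0.symm)
  have hsd : ∀ z ∈ ball (0 : ℂ) r, HasDerivAt s (F (s z)) z := fun z hz => by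
    have hnhds : ball (0 : ℂ) r ∈ nhds z := isOpen_ball.mem_nhds hz
    have hcont : ContinuousAt s z := by
      refine continuousAt_of_locally_lipschitz (r := r - ‖z‖) (K := r⁻¹)
        (sub_pos.mpr (mem_ball_zero_iff.mp hz)) fun y hy => ?_
      have hy' : y ∈ ball (0 : ℂ) r := by
        rw [dist_eq_norm] at hy
        rw [mem_ball_zero_iff]
        linarith [norm_le_norm_add_norm_sub' y z]
      have := hexp _ (hs1 _ hz) _ (hs1 _ hy')
      rw [hGs _ hz, hGs _ hy'] at this
      rwa [dist_eq_norm, dist_eq_norm, inv_mul_eq_div, le_div_iff₀' hr0]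
    simpa using HasDerivAt.of_local_left_inverse hcont (hG _ (hs1 _ hz)) (hF' _ (hs1 _ hz))
      (Filter.mem_of_superset hnhds fun y hy => hGs y hy)
  refine ⟨s, ⟨⟨hs0, hsd⟩, hs1⟩, ?_⟩
  rintro t ⟨ht0, htd⟩
  have hanalytic : ∀ f f' : ℂ → ℂ, (∀ z ∈ ball (0 : ℂ) r, HasDerivAt f (f' z) z) →
      AnalyticOnNhd ℂ f (ball 0 r) := fun f f' h =>
    DifferentiableOn.analyticOnNhd
      (fun z hz => (h z hz).differentiableAt.differentiableWithinAt) isOpen_ball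
  refine (hanalytic t _ htd).eqOn_of_preconnected_of_eventuallyEq (hanalytic s _ hsd)
    (convex_ball _ _).isPreconnected hr0mem ?_
  have htcont : ContinuousAt t 0 := (htd 0 hr0mem).continuousAt
  have hev : ∀ᶠ z in nhds (0 : ℂ), z ∈ ball (0 : ℂ) r ∧ t z ∈ ball (0 : ℂ) 1 :=
    (ball_mem_nhds (0 : ℂ) hr0 |> Filter.eventually_mem_set.mpr).and
      (htcont.eventually (by rw [ht0]; exact isOpen_ball.mem_nhds h0))
  obtain ⟨ε, hε, hball⟩ := Metric.eventually_nhds_iff_ball.mp hev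
  have hGt : EqOn (fun z => G (t z)) id (ball 0 ε) := by
    have hd : ∀ z ∈ ball (0 : ℂ) ε, HasDerivAt (fun z => G (t z)) 1 z := fun z hz => by
      obtain ⟨hzr, htz⟩ := hball z hz
      have := (hG _ htz).comp z (htd z hzr)
      rwa [inv_mul_cancel₀ (hF0 _ htz)] at this
    refine isOpen_ball.eqOn_of_deriv_eq (convex_ball _ _).isPreconnected
      (fun z hz => (hd z hz).differentiableAt.differentiableWithinAt) differentiableOn_id
      (fun z hz => ?_) (mem_ball_self hε) (by simp [ht0, hG0])
    rw [(hd z hz).deriv, deriv_id]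
  filter_upwards [ball_mem_nhds (0 : ℂ) hε] with z hz
  obtain ⟨hzr, htz⟩ := hball z hz
  exact hinj htz (hs1 _ hzr) ((hGt hz).trans (hGs _ hzr).symm)
end

section
/- There exists a unique pair (c, s) of holomorphic functions on the open disc B_r(0) of radius r = 2^(-2/3) about 0 satisfying the initial value problem IVP: c(0) = 1, s(0) = 0, and for every z in B_r(0), c'(z) = -s(z)^2 and s'(z) = c(z)^2. -/
open Complex Metric Set

/-- The Taylor coefficients at `0` of the solution `(c, s)` of the initial value problem. -/
noncomputable def dixonCoeff : ℕ → ℂ × ℂ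
  | 0 => (1, 0)
  | n + 1 =>
    (-(∑ i : Fin (n + 1), (dixonCoeff i).2 * (dixonCoeff (n - i)).2) / (n + 1),
      (∑ i : Fin (n + 1), (dixonCoeff i).1 * (dixonCoeff (n - i)).1) / (n + 1))
  decreasing_by all_goals omega

theorem dixonCoeff_zero : dixonCoeff 0 = (1, 0) := by
  rw [dixonCoeff]

theorem dixonCoeff_succ_fst (n : ℕ) :
    (n + 1) * (dixonCoeff (n + 1)).1 =
      -∑ i ∈ Finset.range (n + 1), (dixonCoeff i).2 * (dixonCoeff (n - i)).2 := by
  have h : (n + 1 : ℂ) ≠ 0 := Nat.cast_add_one_ne_zero n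
  rw [dixonCoeff, Finset.sum_range]
  field_simp

theorem dixonCoeff_succ_snd (n : ℕ) :
    (n + 1) * (dixonCoeff (n + 1)).2 =
      ∑ i ∈ Finset.range (n + 1), (dixonCoeff i).1 * (dixonCoeff (n - i)).1 := by
  have h : (n + 1 : ℂ) ≠ 0 := Nat.cast_add_one_ne_zero n
  rw [dixonCoeff, Finset.sum_range]
  field_simp

theorem norm_sum_range_mul_sub_le {a : ℕ → ℂ} {n : ℕ} (ha : ∀ i ≤ n, ‖a i‖ ≤ 1) :
    ‖∑ i ∈ Finset.range (n + 1), a i * a (n - i)‖ ≤ n + 1 := by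
  have h : (n + 1 : ℝ) = ∑ i ∈ Finset.range (n + 1), (1 : ℝ) := by simp
  rw [h]
  refine norm_sum_le_of_le _ fun i hi ↦ ?_
  rw [norm_mul]
  exact mul_le_one₀ (ha i (by simp at hi; omega)) (norm_nonneg _) (ha _ (by omega))

theorem norm_dixonCoeff_le_one (n : ℕ) : ‖dixonCoeff n‖ ≤ 1 := by
  induction n using Nat.strong_induction_on with
  | _ n ih =>
    cases n with
    | zero => simp [dixonCoeff_zero]
    | succ n =>
      have hn : ‖(n + 1 : ℂ)‖ = n + 1 := by
        exact_mod_cast Complex.norm_natCast (n + 1)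
      have hpos : (0 : ℝ) < n + 1 := by positivity
      refine norm_prod_le_iff.2 ⟨?_, ?_⟩ <;> refine le_of_mul_le_mul_left ?_ hpos <;>
        rw [← hn, ← norm_mul, hn, mul_one]
      · rw [dixonCoeff_succ_fst, norm_neg]
        exact norm_sum_range_mul_sub_le fun i hi ↦ (norm_snd_le _).trans (ih i (by omega))
      · rw [dixonCoeff_succ_snd]
        exact norm_sum_range_mul_sub_le fun i hi ↦ (norm_fst_le _).trans (ih i (by omega))

section PowerSeries

variable {a : ℕ → ℂ} {z : ℂ}

theorem summable_norm_mul_pow_of_norm_le_one (ha : ∀ n, ‖a n‖ ≤ 1) (hz : ‖z‖ < 1) :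
    Summable fun n ↦ ‖a n * z ^ n‖ := by
  refine .of_nonneg_of_le (fun _ ↦ norm_nonneg _) (fun n ↦ ?_)
    (summable_geometric_of_lt_one (norm_nonneg z) hz)
  rw [norm_mul, norm_pow]
  exact mul_le_of_le_one_left (by positivity) (ha n)

theorem tsum_mul_pow_sq_of_norm_le_one (ha : ∀ n, ‖a n‖ ≤ 1) (hz : ‖z‖ < 1) :
    (∑' n, a n * z ^ n) ^ 2 =
      ∑' n, (∑ i ∈ Finset.range (n + 1), a i * a (n - i)) * z ^ n := by
  have hs := summable_norm_mul_pow_of_norm_le_one ha hz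
  rw [sq, tsum_mul_tsum_eq_tsum_sum_range_of_summable_norm hs hs]
  refine tsum_congr fun n ↦ ?_
  rw [Finset.sum_mul]
  refine Finset.sum_congr rfl fun i hi ↦ ?_
  rw [mul_mul_mul_comm, ← pow_add, Nat.add_sub_of_le (by simp at hi; omega)]

theorem hasDerivAt_tsum_mul_pow_of_norm_le_one (ha : ∀ n, ‖a n‖ ≤ 1) (hz : ‖z‖ < 1) :
    HasDerivAt (fun w ↦ ∑' n, a n * w ^ n) (∑' n : ℕ, (n + 1) * a (n + 1) * z ^ n) z := by
  obtain ⟨ρ, hzρ, hρ⟩ := exists_between hz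
  have hρ0 : 0 < ρ := (norm_nonneg z).trans_lt hzρ
  have hu : Summable fun n : ℕ ↦ (n : ℝ) * ρ ^ (n - 1) := by
    refine (summable_nat_add_iff 1).1 ?_
    have h1 := summable_pow_mul_geometric_of_norm_lt_one 1
      (r := ρ) (by rwa [Real.norm_of_nonneg hρ0.le])
    have h0 := summable_geometric_of_lt_one hρ0.le hρ
    refine (h1.add h0).congr fun n ↦ ?_
    push_cast
    simp
    ring
  have hbound : ∀ (n : ℕ) (w : ℂ), w ∈ ball (0 : ℂ) ρ →
      ‖a n * (n * w ^ (n - 1))‖ ≤ n * ρ ^ (n - 1) := by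
    intro n w hw
    rw [mem_ball_zero_iff] at hw
    rw [norm_mul, norm_mul, norm_pow, Complex.norm_natCast]
    refine (mul_le_of_le_one_left (by positivity) (ha n)).trans ?_
    gcongr
  have hzmem : z ∈ ball (0 : ℂ) ρ := mem_ball_zero_iff.2 hzρ
  have hd := hasDerivAt_tsum_of_isPreconnected hu isOpen_ball
    (convex_ball (0 : ℂ) ρ).isPreconnected
    (fun n w _ ↦ (hasDerivAt_pow n w).const_mul (a n)) hbound hzmem
    (summable_norm_mul_pow_of_norm_le_one ha hz).of_norm hzmem
  refine hd.congr_deriv ?_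
  rw [(hu.of_norm_bounded fun n ↦ hbound n z hzmem).tsum_eq_zero_add]
  simp only [Nat.cast_zero, zero_mul, mul_zero, zero_add]
  refine tsum_congr fun n ↦ ?_
  rw [Nat.add_sub_cancel]
  push_cast
  ring

end PowerSeries

theorem exists_dixon_IVP_solution_unit_ball :
    ∃ c s : ℂ → ℂ, c 0 = 1 ∧ s 0 = 0 ∧
      ∀ z ∈ ball (0 : ℂ) 1, HasDerivAt c (-(s z) ^ 2) z ∧ HasDerivAt s ((c z) ^ 2) z := by
  have hc (n : ℕ) : ‖(dixonCoeff n).1‖ ≤ 1 := (norm_fst_le _).trans (norm_dixonCoeff_le_one n)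
  have hs (n : ℕ) : ‖(dixonCoeff n).2‖ ≤ 1 := (norm_snd_le _).trans (norm_dixonCoeff_le_one n)
  refine ⟨fun z ↦ ∑' n, (dixonCoeff n).1 * z ^ n, fun z ↦ ∑' n, (dixonCoeff n).2 * z ^ n,
    ?_, ?_, fun z hz ↦ ⟨?_, ?_⟩⟩
  · dsimp only
    rw [tsum_eq_single 0 fun n hn ↦ by simp [hn]]
    simp [dixonCoeff_zero]
  · dsimp only
    rw [tsum_eq_single 0 fun n hn ↦ by simp [hn]]
    simp [dixonCoeff_zero]
  · rw [mem_ball_zero_iff] at hz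
    refine (hasDerivAt_tsum_mul_pow_of_norm_le_one hc hz).congr_deriv ?_
    simp_rw [tsum_mul_pow_sq_of_norm_le_one hs hz, dixonCoeff_succ_fst, neg_mul, tsum_neg]
  · rw [mem_ball_zero_iff] at hz
    refine (hasDerivAt_tsum_mul_pow_of_norm_le_one hs hz).congr_deriv ?_
    simp_rw [tsum_mul_pow_sq_of_norm_le_one hc hz, dixonCoeff_succ_snd]

theorem eqOn_ball_of_dixon_IVP {r : ℝ} {C S c s : ℂ → ℂ} (hC0 : C 0 = c 0) (hS0 : S 0 = s 0)
    (hCS : ∀ z ∈ ball (0 : ℂ) r,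
      HasDerivAt C (-(S z) ^ 2) z ∧ HasDerivAt S ((C z) ^ 2) z)
    (hcs : ∀ z ∈ ball (0 : ℂ) r,
      HasDerivAt c (-(s z) ^ 2) z ∧ HasDerivAt s ((c z) ^ 2) z) :
    EqOn C c (ball 0 r) ∧ EqOn S s (ball 0 r) := by
  suffices h : ∀ z ∈ ball (0 : ℂ) r, (C z - c z, S z - s z) = (0, 0) by
    constructor <;> intro z hz
    · exact sub_eq_zero.1 (congrArg Prod.fst (h z hz))
    · exact sub_eq_zero.1 (congrArg Prod.snd (h z hz))
  intro z hz
  rw [mem_ball_zero_iff] at hz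
  have hmem : ∀ t ∈ Icc (0 : ℝ) 1, (t : ℂ) * z ∈ ball (0 : ℂ) r := by
    intro t ht
    rw [mem_ball_zero_iff, norm_mul, Complex.norm_real, Real.norm_of_nonneg ht.1]
    exact (mul_le_of_le_one_left (norm_nonneg z) ht.2).trans_lt hz
  have hline (t : ℝ) : HasDerivAt (fun t : ℝ ↦ (t : ℂ) * z) z t := by
    simpa using (hasDerivAt_id (t : ℂ)).comp_ofReal.mul_const z
  have hderiv : ∀ t ∈ Icc (0 : ℝ) 1,
      HasDerivAt (fun t : ℝ ↦ (C (t * z) - c (t * z), S (t * z) - s (t * z)))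
        ((-(S (t * z)) ^ 2) * z - (-(s (t * z)) ^ 2) * z,
          (C (t * z)) ^ 2 * z - (c (t * z)) ^ 2 * z) t := by
    intro t ht
    have hm := hmem t ht
    exact (((hCS _ hm).1.comp t (hline t)).sub ((hcs _ hm).1.comp t (hline t))).prodMk
      (((hCS _ hm).2.comp t (hline t)).sub ((hcs _ hm).2.comp t (hline t)))
  have hcont {f : ℂ → ℂ} (hf : ∀ w ∈ ball (0 : ℂ) r, ContinuousAt f w) :
      ContinuousOn (fun t : ℝ ↦ f (t * z)) (Icc 0 1) := fun t ht ↦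
    (ContinuousAt.comp (f := fun t : ℝ ↦ (t : ℂ) * z) (hf _ (hmem t ht))
      (hline t).continuousAt).continuousWithinAt
  obtain ⟨K₁, hK₁⟩ := isCompact_Icc.exists_bound_of_continuousOn
    (((hcont fun w hw ↦ (hCS w hw).1.continuousAt).add
      (hcont fun w hw ↦ (hcs w hw).1.continuousAt)).mul_const z)
  obtain ⟨K₂, hK₂⟩ := isCompact_Icc.exists_bound_of_continuousOn
    (((hcont fun w hw ↦ (hCS w hw).2.continuousAt).add
      (hcont fun w hw ↦ (hcs w hw).2.continuousAt)).mul_const z)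
  have key := eq_zero_of_abs_deriv_le_mul_abs_self_of_eq_zero_right (K := max K₁ K₂)
    (fun t ht ↦ (hderiv t ht).continuousAt.continuousWithinAt)
    (fun t ht ↦ (hderiv t (Ico_subset_Icc_self ht)).hasDerivWithinAt)
    (by simp [hC0, hS0]) ?_ 1 (right_mem_Icc.2 zero_le_one)
  · simpa using key
  · intro t ht
    have ht' := Ico_subset_Icc_self ht
    refine norm_prod_le_iff.2 ⟨?_, ?_⟩
    · calc ‖(-(S (t * z)) ^ 2) * z - (-(s (t * z)) ^ 2) * z‖
          = ‖(S (t * z) + s (t * z)) * z‖ * ‖S (t * z) - s (t * z)‖ := by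
            rw [← norm_mul, ← norm_neg]; congr 1; ring
        _ ≤ _ := mul_le_mul ((hK₂ t ht').trans (le_max_right _ _)) (le_max_right _ _)
            (norm_nonneg _) ((norm_nonneg _).trans ((hK₂ t ht').trans (le_max_right _ _)))
    · calc ‖(C (t * z)) ^ 2 * z - (c (t * z)) ^ 2 * z‖
          = ‖(C (t * z) + c (t * z)) * z‖ * ‖C (t * z) - c (t * z)‖ := by
            rw [← norm_mul]; congr 1; ring
        _ ≤ _ := mul_le_mul ((hK₁ t ht').trans (le_max_left _ _)) (le_max_left _ _)
            (norm_nonneg _) ((norm_nonneg _).trans ((hK₁ t ht').trans (le_max_left _ _)))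

/-- There exists a unique pair `(c, s)` of holomorphic functions on the
open disc `B_r(0)`, `r = 2^(-2/3)`, solving the IVP:
`c 0 = 1`, `s 0 = 0`, `c' = -s^2`, `s' = c^2`. -/
theorem dixon_IVP_existence_uniqueness (r : ℝ) (hr : r = (2:ℝ) ^ (-(2/3) : ℝ)) :
    ∃ c s : ℂ → ℂ,
      (c 0 = 1 ∧ s 0 = 0 ∧
        ∀ z ∈ Metric.ball (0:ℂ) r,
          HasDerivAt c (-(s z) ^ 2) z ∧ HasDerivAt s ((c z) ^ 2) z) ∧
      ∀ C S : ℂ → ℂ,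
        (C 0 = 1 ∧ S 0 = 0 ∧
          ∀ z ∈ Metric.ball (0:ℂ) r,
            HasDerivAt C (-(S z) ^ 2) z ∧ HasDerivAt S ((C z) ^ 2) z) →
        Set.EqOn C c (Metric.ball (0:ℂ) r) ∧ Set.EqOn S s (Metric.ball (0:ℂ) r) := by
  have hr1 : r ≤ 1 := hr.trans_le (Real.rpow_le_one_of_one_le_of_nonpos one_le_two (by norm_num))
  obtain ⟨c, s, hc0, hs0, hcs⟩ := exists_dixon_IVP_solution_unit_ball
  have hcs' := fun z (hz : z ∈ Metric.ball (0 : ℂ) r) ↦ hcs z (ball_subset_ball hr1 hz)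
  exact ⟨c, s, ⟨hc0, hs0, hcs'⟩, fun C S ⟨hC0, hS0, hCS⟩ ↦
    eqOn_ball_of_dixon_IVP (hC0.trans hc0.symm) (hS0.trans hs0.symm) hCS hcs'⟩
end

section
/- If (c, s) is a pair of holomorphic functions solving the initial value problem IVP on a connected open subset U of the complex plane containing 0, then for every z in U one has c(z)^3 + s(z)^3 = 1. -/
open Complex Metric Set

/-- If `(c, s)` solves the IVP on a connected open set `U ∋ 0`, then
`c z ^ 3 + s z ^ 3 = 1` for every `z ∈ U`. -/
theorem dixon_cube_identity (U : Set ℂ) (hU : IsOpen U) (hconn : IsConnected U)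
    (h0 : (0:ℂ) ∈ U) (c s : ℂ → ℂ) (hc0 : c 0 = 1) (hs0 : s 0 = 0)
    (hderiv : ∀ z ∈ U, HasDerivAt c (-(s z) ^ 2) z ∧ HasDerivAt s ((c z) ^ 2) z) :
    ∀ z ∈ U, c z ^ 3 + s z ^ 3 = 1 := by
  have hd : ∀ z ∈ U, HasDerivAt (fun w => c w ^ 3 + s w ^ 3) 0 z := by
    intro z hz
    obtain ⟨hc, hs⟩ := hderiv z hz
    refine ((hc.fun_pow 3).fun_add (hs.fun_pow 3)).congr_deriv ?_
    push_cast
    ring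
  intro z hz
  have h := hU.is_const_of_deriv_eq_zero hconn.isPreconnected
    (fun w hw => (hd w hw).differentiableAt.differentiableWithinAt)
    (fun w hw => (hd w hw).deriv) hz h0
  simpa [hc0, hs0] using h
end

section
/- Let (c, s) solve the initial value problem IVP on the open disc B_r(0) with r = 2^(-2/3). Then for every z in B_r(0), c(-z) · c(z) = 1 and s(-z) · c(z) = -s(z); in particular c is nowhere zero on B_r(0), c(-z) = 1/c(z) and s(-z) = -s(z)/c(z). -/
open Complex Metric Set

/-- Two differentiable curves that solve `x' = y ^ 2`, `y' = -x ^ 2` near `0` with the same initial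
value agree near `0`. -/
theorem eventuallyEq_of_hasDerivAt_sq {x y u v : ℝ → ℂ}
    (hx : ∀ᶠ t in nhds 0, HasDerivAt x (y t ^ 2) t)
    (hy : ∀ᶠ t in nhds 0, HasDerivAt y (-x t ^ 2) t)
    (hu : ∀ᶠ t in nhds 0, HasDerivAt u (v t ^ 2) t)
    (hv : ∀ᶠ t in nhds 0, HasDerivAt v (-u t ^ 2) t)
    (hxu : x 0 = u 0) (hyv : y 0 = v 0) :
    ∀ᶠ t in nhds 0, x t = u t ∧ y t = v t := by
  have hV : ContDiff ℝ 1 (fun p : ℂ × ℂ => (p.2 ^ 2, -p.1 ^ 2)) := by fun_prop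
  obtain ⟨K, N, hN, hK⟩ := (hV.contDiffAt (x := (x 0, y 0))).exists_lipschitzOnWith
  have hxy : ContinuousAt (fun t => (x t, y t)) 0 :=
    hx.self_of_nhds.continuousAt.prodMk hy.self_of_nhds.continuousAt
  have huv : ContinuousAt (fun t => (u t, v t)) 0 :=
    hu.self_of_nhds.continuousAt.prodMk hv.self_of_nhds.continuousAt
  have hN' : N ∈ nhds (u 0, v 0) := by rwa [← hxu, ← hyv]
  have key := ODE_solution_unique_of_eventually (v := fun _ p => (p.2 ^ 2, -p.1 ^ 2))
    (s := fun _ => N) (K := K) (f := fun t => (x t, y t)) (g := fun t => (u t, v t)) (t₀ := 0)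
    (.of_forall fun _ => hK)
    (by filter_upwards [hx, hy, hxy hN] with t h₁ h₂ h₃ using ⟨h₁.prodMk h₂, h₃⟩)
    (by filter_upwards [hu, hv, huv hN'] with t h₁ h₂ h₃ using ⟨h₁.prodMk h₂, h₃⟩)
    (by simp only [hxu, hyv])
  filter_upwards [key] with t ht using Prod.mk.inj ht

/-- Solutions of `c' = -s ^ 2`, `s' = c ^ 2` preserve the Fermat cubic. -/
theorem cube_add_cube_eq_one {r : ℝ} {c s : ℂ → ℂ} (hc0 : c 0 = 1) (hs0 : s 0 = 0)
    (hderiv : ∀ z ∈ ball (0 : ℂ) r, HasDerivAt c (-(s z) ^ 2) z ∧ HasDerivAt s ((c z) ^ 2) z)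
    {z : ℂ} (hz : z ∈ ball (0 : ℂ) r) : c z ^ 3 + s z ^ 3 = 1 := by
  have hd : ∀ w ∈ ball (0 : ℂ) r, HasDerivAt (fun w => c w ^ 3 + s w ^ 3) 0 w := fun w hw => by
    refine (((hderiv w hw).1.pow 3).add ((hderiv w hw).2.pow 3)).congr_deriv ?_
    push_cast
    ring
  have h0 : (0 : ℂ) ∈ ball (0 : ℂ) r := mem_ball_self (pos_of_mem_ball hz)
  have h := isOpen_ball.is_const_of_deriv_eq_zero (convex_ball (0 : ℂ) r).isPreconnected
    (fun w hw => (hd w hw).differentiableAt.differentiableWithinAt) (fun w hw => (hd w hw).deriv)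
    hz h0
  simpa [hc0, hs0] using h

/-- If `(c, s)` solves the IVP on `B_r(0)`, `r = 2^(-2/3)`, then for
every `z` in the disc: `c (-z) * c z = 1`, `s (-z) * c z = -s z`; in particular
`c z ≠ 0`, `c (-z) = 1 / c z` and `s (-z) = -s z / c z`. -/
theorem dixon_negation (r : ℝ) (hr : r = (2:ℝ) ^ (-(2/3) : ℝ)) (c s : ℂ → ℂ)
    (hc0 : c 0 = 1) (hs0 : s 0 = 0)
    (hderiv : ∀ z ∈ Metric.ball (0:ℂ) r,
      HasDerivAt c (-(s z) ^ 2) z ∧ HasDerivAt s ((c z) ^ 2) z) :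
    ∀ z ∈ Metric.ball (0:ℂ) r,
      c (-z) * c z = 1 ∧ s (-z) * c z = -s z ∧
      c z ≠ 0 ∧ c (-z) = 1 / c z ∧ s (-z) = -s z / c z := by
  have hr0 : 0 < r := hr ▸ by positivity
  have h0 : (0 : ℂ) ∈ ball (0 : ℂ) r := mem_ball_self hr0
  have hneg : ∀ z ∈ ball (0 : ℂ) r, -z ∈ ball (0 : ℂ) r := fun z hz => by simpa using hz
  have hC : ∀ z ∈ ball (0 : ℂ) r, HasDerivAt (fun w => c (-w)) (s (-z) ^ 2) z := fun z hz =>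
    ((hderiv _ (hneg z hz)).1.comp z (hasDerivAt_neg z)).congr_deriv (by ring)
  have hS : ∀ z ∈ ball (0 : ℂ) r, HasDerivAt (fun w => s (-w)) (-c (-z) ^ 2) z := fun z hz =>
    ((hderiv _ (hneg z hz)).2.comp z (hasDerivAt_neg z)).congr_deriv (by ring)
  have hcoe : Filter.Tendsto ((↑) : ℝ → ℂ) (nhds 0) (nhds 0) := by
    simpa using continuous_ofReal.tendsto 0
  have hball : ∀ᶠ t : ℝ in nhds 0, (t : ℂ) ∈ ball (0 : ℂ) r :=
    hcoe.eventually (isOpen_ball.mem_nhds h0)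
  have hne : ∀ᶠ t : ℝ in nhds 0, c t ≠ 0 :=
    hcoe.eventually ((hderiv 0 h0).1.continuousAt.eventually_ne (by simp [hc0]))
  have hreal : ∀ᶠ t : ℝ in nhds 0, c (-t) = (c t)⁻¹ ∧ s (-t) = -s t / c t := by
    refine eventuallyEq_of_hasDerivAt_sq (x := fun t => c (-t)) (y := fun t => s (-t))
      (u := fun t => (c t)⁻¹) (v := fun t => -s t / c t) ?_ ?_ ?_ ?_ ?_ ?_
    · filter_upwards [hball] with t ht using (hC t ht).comp_ofReal
    · filter_upwards [hball] with t ht using (hS t ht).comp_ofReal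
    · filter_upwards [hball, hne] with t ht hct
      refine ((hderiv t ht).1.inv hct).comp_ofReal.congr_deriv ?_
      field_simp
    · filter_upwards [hball, hne] with t ht hct
      refine ((hderiv t ht).2.neg.div (hderiv t ht).1 hct).comp_ofReal.congr_deriv ?_
      have h3 := cube_add_cube_eq_one hc0 hs0 hderiv ht
      simp only [Pi.neg_apply]
      field_simp
      linear_combination -h3
    · simp [hc0]
    · simp [hs0]
  have hpunct : Filter.Tendsto ((↑) : ℝ → ℂ) (nhdsWithin 0 {0}ᶜ) (nhdsWithin 0 {0}ᶜ) :=
    tendsto_nhdsWithin_of_tendsto_nhds_of_eventually_within _ (hcoe.mono_left nhdsWithin_le_nhds)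
      (by filter_upwards [self_mem_nhdsWithin] with t ht using by simpa using ht)
  have extend : ∀ f g : ℂ → ℂ, DifferentiableOn ℂ f (ball 0 r) → DifferentiableOn ℂ g (ball 0 r) →
      (∀ᶠ t : ℝ in nhds 0, f t = g t) → EqOn f g (ball 0 r) := fun f g hf hg hfg =>
    (hf.analyticOnNhd isOpen_ball).eqOn_of_preconnected_of_frequently_eq
      (hg.analyticOnNhd isOpen_ball) (convex_ball (0 : ℂ) r).isPreconnected h0
      (hpunct.frequently (hfg.filter_mono nhdsWithin_le_nhds).frequently)
  have hcd : DifferentiableOn ℂ c (ball 0 r) := fun z hz =>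
    (hderiv z hz).1.differentiableAt.differentiableWithinAt
  have hsd : DifferentiableOn ℂ s (ball 0 r) := fun z hz =>
    (hderiv z hz).2.differentiableAt.differentiableWithinAt
  have hCd : DifferentiableOn ℂ (fun z => c (-z)) (ball 0 r) := fun z hz =>
    (hC z hz).differentiableAt.differentiableWithinAt
  have hSd : DifferentiableOn ℂ (fun z => s (-z)) (ball 0 r) := fun z hz =>
    (hS z hz).differentiableAt.differentiableWithinAt
  have hmulc : EqOn (fun z => c (-z) * c z) (fun _ => 1) (ball 0 r) :=
    extend _ _ (hCd.mul hcd) (differentiableOn_const 1) (by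
      filter_upwards [hreal, hne] with t ht hct
      rw [ht.1, inv_mul_cancel₀ hct])
  have hmuls : EqOn (fun z => s (-z) * c z) (fun z => -s z) (ball 0 r) :=
    extend _ _ (hSd.mul hcd) hsd.neg (by
      filter_upwards [hreal, hne] with t ht hct
      rw [ht.2, div_mul_cancel₀ _ hct])
  intro z hz
  have hcz : c z ≠ 0 := right_ne_zero_of_mul_eq_one (hmulc hz)
  exact ⟨hmulc hz, hmuls hz, hcz, eq_div_of_mul_eq hcz (hmulc hz), eq_div_of_mul_eq hcz (hmuls hz)⟩
end

section
/- Let (c, s) solve the initial value problem IVP on the open disc B_r(0) with r = 2^(-2/3), and let γ = exp(2πi/3) = (-1 + i√3)/2. Then for every z in B_r(0), s(γz) = γ · s(z) and c(γz) = c(z). -/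
open Complex Metric Set

/-- Solutions of `c' = -s ^ 2`, `s' = c ^ 2` on a disc centred at `0` are determined by their
values at `0`. -/
theorem dixon_system_unique {r : ℝ} {c s C S : ℂ → ℂ}
    (h : ∀ z ∈ ball (0 : ℂ) r, HasDerivAt c (-(s z) ^ 2) z ∧ HasDerivAt s ((c z) ^ 2) z)
    (H : ∀ z ∈ ball (0 : ℂ) r, HasDerivAt C (-(S z) ^ 2) z ∧ HasDerivAt S ((C z) ^ 2) z)
    (hc0 : c 0 = C 0) (hs0 : s 0 = S 0) :
    ∀ z ∈ ball (0 : ℂ) r, c z = C z ∧ s z = S z := by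
  intro z hz
  have hmem : ∀ t ∈ Icc (0 : ℝ) 1, (t : ℂ) * z ∈ ball (0 : ℂ) r := by
    intro t ht
    rw [mem_ball_zero_iff] at hz ⊢
    rw [norm_mul, norm_real, Real.norm_of_nonneg ht.1]
    exact (mul_le_of_le_one_left (norm_nonneg z) ht.2).trans_lt hz
  have along {f : ℂ → ℂ} {f' : ℂ} (t : ℝ) (hf : HasDerivAt f f' (t * z)) :
      HasDerivAt (fun x : ℝ => f (x * z)) (f' * z) t := by
    have hline : HasDerivAt (fun x : ℝ => (x : ℂ) * z) z t := by
      simpa using (hasDerivAt_id t).ofReal_comp.mul_const z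
    exact hf.comp t hline
  let F : ℝ → ℂ × ℂ := fun t => (c (t * z) - C (t * z), s (t * z) - S (t * z))
  let F' : ℝ → ℂ × ℂ := fun t =>
    (-(s (t * z)) ^ 2 * z - -(S (t * z)) ^ 2 * z, c (t * z) ^ 2 * z - C (t * z) ^ 2 * z)
  have hF : ∀ t ∈ Icc (0 : ℝ) 1, HasDerivAt F (F' t) t := fun t ht =>
    ((along t (h _ (hmem t ht)).1).sub (along t (H _ (hmem t ht)).1)).prodMk
      ((along t (h _ (hmem t ht)).2).sub (along t (H _ (hmem t ht)).2))
  have hcont : ContinuousOn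
      (fun t : ℝ => ((c (t * z) + C (t * z)) * z, (s (t * z) + S (t * z)) * z)) (Icc 0 1) := by
    intro t ht
    have h1 := (along t (h _ (hmem t ht)).1).continuousAt
    have h2 := (along t (h _ (hmem t ht)).2).continuousAt
    have h3 := (along t (H _ (hmem t ht)).1).continuousAt
    have h4 := (along t (H _ (hmem t ht)).2).continuousAt
    exact (((h1.add h3).mul continuousAt_const).prodMk
      ((h2.add h4).mul continuousAt_const)).continuousWithinAt
  obtain ⟨K, hK⟩ := isCompact_Icc.exists_bound_of_continuousOn hcont
  have hzero := eq_zero_of_abs_deriv_le_mul_abs_self_of_eq_zero_right (f := F) (f' := F') (K := K)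
    (a := 0) (b := 1) (fun t ht => (hF t ht).continuousAt.continuousWithinAt)
    (fun t ht => (hF t (Ico_subset_Icc_self ht)).hasDerivWithinAt)
    (by simp [F, hc0, hs0]) (by
      intro t ht
      obtain ⟨hKc, hKs⟩ := norm_prod_le_iff.mp (hK t (Ico_subset_Icc_self ht))
      have hK0 : 0 ≤ K := (norm_nonneg _).trans hKc
      refine norm_prod_le_iff.mpr ⟨?_, ?_⟩
      · have : (F' t).1 = -(((s (t * z) + S (t * z)) * z) * (F t).2) := by
          simp only [F, F']; ring
        rw [this, norm_neg, norm_mul]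
        exact mul_le_mul hKs (norm_snd_le _) (norm_nonneg _) hK0
      · have : (F' t).2 = ((c (t * z) + C (t * z)) * z) * (F t).1 := by
          simp only [F, F']; ring
        rw [this, norm_mul]
        exact mul_le_mul hKc (norm_fst_le _) (norm_nonneg _) hK0)
    1 (right_mem_Icc.mpr zero_le_one)
  simpa [F, sub_eq_zero] using hzero

/-- If `(c, s)` solves the IVP on `B_r(0)`, `r = 2^(-2/3)`, and
`γ = exp(2πi/3)`, then for every `z` in the disc, `s (γ*z) = γ * s z` and
`c (γ*z) = c z`. -/
theorem dixon_cube_root_symmetry (r : ℝ) (hr : r = (2:ℝ) ^ (-(2/3) : ℝ))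
    (γ : ℂ) (hγ : γ = Complex.exp (2 * Real.pi * Complex.I / 3)) (c s : ℂ → ℂ)
    (hc0 : c 0 = 1) (hs0 : s 0 = 0)
    (hderiv : ∀ z ∈ Metric.ball (0:ℂ) r,
      HasDerivAt c (-(s z) ^ 2) z ∧ HasDerivAt s ((c z) ^ 2) z) :
    ∀ z ∈ Metric.ball (0:ℂ) r, s (γ * z) = γ * s z ∧ c (γ * z) = c z := by
  have hγ3 : γ ^ 3 = 1 := by
    rw [hγ, ← Complex.exp_nat_mul, ← Complex.exp_two_pi_mul_I]
    congr 1
    push_cast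
    ring
  have hnorm : ‖γ‖ = 1 := norm_eq_one_of_pow_eq_one hγ3 three_ne_zero
  have hrot : ∀ z ∈ ball (0 : ℂ) r, HasDerivAt (fun z => c (γ * z)) (-(γ ^ 2 * s (γ * z)) ^ 2) z ∧
      HasDerivAt (fun z => γ ^ 2 * s (γ * z)) ((c (γ * z)) ^ 2) z := by
    intro z hz
    obtain ⟨hc, hs⟩ := hderiv (γ * z) (by simpa [hnorm] using hz)
    have hmul : HasDerivAt (fun z => γ * z) γ z := by
      simpa using (hasDerivAt_id z).const_mul γ
    constructor
    · refine (hc.comp z hmul).congr_deriv ?_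
      linear_combination (γ * s (γ * z) ^ 2) * hγ3
    · refine ((hs.comp z hmul).const_mul (γ ^ 2)).congr_deriv ?_
      linear_combination (c (γ * z) ^ 2) * hγ3
  intro z hz
  obtain ⟨hc, hs⟩ := dixon_system_unique hderiv hrot (by simp) (by simp [hs0]) z hz
  exact ⟨by linear_combination (-γ) * hs - s (γ * z) * hγ3, hc.symm⟩
end

section
/- Let (c, s) solve the initial value problem IVP on the open disc B_{2r}(0) with r = 2^(-2/3). Then for every z in B_r(0) the duplication formulae hold: s(2z) · c(z) · (1 + s(z)^3) = s(z) · (1 + c(z)^3) and c(2z) · c(z) · (1 + s(z)^3) = c(z)^3 - s(z)^3, where moreover c(z) · (1 + s(z)^3) is nonzero for z in B_r(0). -/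
open Complex Metric Set

open Filter Topology

/-- Two holomorphic integral curves of a `C¹` autonomous vector field which agree at the origin
agree at points accumulating at the origin. -/
lemma frequently_eq_of_hasDerivAt_vectorField {E : Type*} [NormedAddCommGroup E]
    [NormedSpace ℂ E] {v : E → E} {f g : ℂ → E} (hv : ContDiffAt ℝ 1 v (f 0))
    (hf : ∀ᶠ z in 𝓝 0, HasDerivAt f (v (f z)) z)
    (hg : ∀ᶠ z in 𝓝 0, HasDerivAt g (v (g z)) z) (h0 : f 0 = g 0) :
    ∃ᶠ z in 𝓝[≠] (0 : ℂ), f z = g z := by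
  obtain ⟨K, t, ht, hK⟩ := hv.exists_lipschitzOnWith
  have hft : ∀ᶠ z in 𝓝 0, f z ∈ t := hf.self_of_nhds.continuousAt.eventually_mem ht
  have hgt : ∀ᶠ z in 𝓝 0, g z ∈ t := hg.self_of_nhds.continuousAt.eventually_mem (h0 ▸ ht)
  have hofReal : Tendsto (fun x : ℝ => (x : ℂ)) (𝓝 0) (𝓝 0) := by
    simpa using continuous_ofReal.tendsto (0 : ℝ)
  have real_deriv {h : ℂ → E} {h' : E} {x : ℝ} (hh : HasDerivAt h h' (x : ℂ)) :
      HasDerivAt (fun y : ℝ => h y) h' x := by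
    simpa using! hh.scomp x ofRealCLM.hasDerivAt
  have heq : (fun x : ℝ => f x) =ᶠ[𝓝 0] fun x : ℝ => g x :=
    ODE_solution_unique_of_eventually (v := fun _ => v) (s := fun _ => t)
      (Eventually.of_forall fun _ => hK)
      ((hofReal.eventually (hf.and hft)).mono fun x hx => ⟨real_deriv hx.1, hx.2⟩)
      ((hofReal.eventually (hg.and hgt)).mono fun x hx => ⟨real_deriv hx.1, hx.2⟩)
      (by simpa using h0)
  have hne : Tendsto (fun x : ℝ => (x : ℂ)) (𝓝[≠] 0) (𝓝[≠] 0) :=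
    tendsto_nhdsWithin_iff.2 ⟨hofReal.mono_left nhdsWithin_le_nhds,
      eventually_mem_nhdsWithin.mono fun x hx => by simpa using hx⟩
  exact hne.frequently (heq.filter_mono nhdsWithin_le_nhds).frequently

/-- Solutions of the initial value problem parametrize the Fermat cubic. -/
lemma dixon_cube_add_cube {R : ℝ} {c s : ℂ → ℂ} (hc0 : c 0 = 1) (hs0 : s 0 = 0)
    (hderiv : ∀ z ∈ ball (0 : ℂ) R, HasDerivAt c (-(s z) ^ 2) z ∧ HasDerivAt s ((c z) ^ 2) z) :
    ∀ z ∈ ball (0 : ℂ) R, c z ^ 3 + s z ^ 3 = 1 := by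
  intro z hz
  have hd : ∀ w ∈ ball (0 : ℂ) R, HasDerivAt (fun w => c w ^ 3 + s w ^ 3) 0 w := fun w hw => by
    refine (((hderiv w hw).1.pow 3).add ((hderiv w hw).2.pow 3)).congr_deriv ?_
    push_cast
    ring
  have h := isOpen_ball.is_const_of_deriv_eq_zero (convex_ball _ _).isPreconnected
    (fun w hw => (hd w hw).differentiableAt.differentiableWithinAt)
    (fun w hw => (hd w hw).deriv) hz (mem_ball_self (pos_of_mem_ball hz))
  simpa [hc0, hs0] using h

/-- The right-hand sides of the duplication formulae satisfy the equations of the doubled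
curve. -/
lemma dixon_duplication_hasDerivAt {c s : ℂ → ℂ} {z : ℂ} (hc : HasDerivAt c (-(s z) ^ 2) z)
    (hs : HasDerivAt s ((c z) ^ 2) z) (h : c z ^ 3 + s z ^ 3 = 1)
    (hD : c z * (1 + s z ^ 3) ≠ 0) :
    HasDerivAt (fun w => (c w ^ 3 - s w ^ 3) / (c w * (1 + s w ^ 3)))
      (-2 * (s z * (1 + c z ^ 3) / (c z * (1 + s z ^ 3))) ^ 2) z ∧
    HasDerivAt (fun w => s w * (1 + c w ^ 3) / (c w * (1 + s w ^ 3)))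
      (2 * ((c z ^ 3 - s z ^ 3) / (c z * (1 + s z ^ 3))) ^ 2) z := by
  have hD' := hc.mul ((hs.pow 3).const_add 1)
  constructor
  · refine (((hc.pow 3).sub (hs.pow 3)).div hD' hD).congr_deriv ?_
    rw [div_pow, mul_div_assoc']
    refine congrArg (· / _) ?_
    simp only [Pi.pow_apply, Pi.sub_apply, Pi.mul_apply]
    push_cast
    linear_combination -s z ^ 2 * (2 + (c z ^ 3 + s z ^ 3)) * h
  · refine ((hs.mul ((hc.pow 3).const_add 1)).div hD' hD).congr_deriv ?_
    rw [div_pow, mul_div_assoc']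
    refine congrArg (· / _) ?_
    simp only [Pi.pow_apply, Pi.mul_apply]
    push_cast
    linear_combination -(c z ^ 3 + s z ^ 3 + 2 * c z ^ 3 * s z ^ 3) * h

/-- If `(c, s)` solves the IVP on `B_{2r}(0)`, `r = 2^(-2/3)`, then for
every `z ∈ B_r(0)` the duplication formulae hold (in cross-multiplied form), the common
denominator `c z * (1 + s z ^ 3)` being nonzero. -/
theorem dixon_duplication (r : ℝ) (hr : r = (2:ℝ) ^ (-(2/3) : ℝ)) (c s : ℂ → ℂ)
    (hc0 : c 0 = 1) (hs0 : s 0 = 0)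
    (hderiv : ∀ z ∈ Metric.ball (0:ℂ) (2 * r),
      HasDerivAt c (-(s z) ^ 2) z ∧ HasDerivAt s ((c z) ^ 2) z) :
    ∀ z ∈ Metric.ball (0:ℂ) r,
      c z * (1 + s z ^ 3) ≠ 0 ∧
      s (2 * z) * (c z * (1 + s z ^ 3)) = s z * (1 + c z ^ 3) ∧
      c (2 * z) * (c z * (1 + s z ^ 3)) = c z ^ 3 - s z ^ 3 := by
  have hr0 : 0 < r := hr ▸ Real.rpow_pos_of_pos two_pos _
  have hcube := dixon_cube_add_cube hc0 hs0 hderiv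
  have hsub : ball (0 : ℂ) r ⊆ ball 0 (2 * r) := ball_subset_ball (by linarith)
  have hdouble : ∀ z ∈ ball (0 : ℂ) r, 2 * z ∈ ball (0 : ℂ) (2 * r) := by
    intro z hz
    simpa using hz
  have hc : DifferentiableOn ℂ c (ball 0 r) := fun z hz =>
    (hderiv z (hsub hz)).1.differentiableAt.differentiableWithinAt
  have hs : DifferentiableOn ℂ s (ball 0 r) := fun z hz =>
    (hderiv z (hsub hz)).2.differentiableAt.differentiableWithinAt
  have hc2_deriv : ∀ z ∈ ball (0 : ℂ) r,
      HasDerivAt (fun w => c (2 * w)) (-2 * s (2 * z) ^ 2) z := fun z hz => by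
    refine ((hderiv _ (hdouble z hz)).1.comp z ((hasDerivAt_id z).const_mul 2)).congr_deriv ?_
    ring
  have hs2_deriv : ∀ z ∈ ball (0 : ℂ) r,
      HasDerivAt (fun w => s (2 * w)) (2 * c (2 * z) ^ 2) z := fun z hz => by
    refine ((hderiv _ (hdouble z hz)).2.comp z ((hasDerivAt_id z).const_mul 2)).congr_deriv ?_
    ring
  have hc2 : DifferentiableOn ℂ (fun z => c (2 * z)) (ball 0 r) := fun z hz =>
    (hc2_deriv z hz).differentiableAt.differentiableWithinAt
  have hs2 : DifferentiableOn ℂ (fun z => s (2 * z)) (ball 0 r) := fun z hz =>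
    (hs2_deriv z hz).differentiableAt.differentiableWithinAt
  have hball : ball (0 : ℂ) r ∈ 𝓝 0 := ball_mem_nhds _ hr0
  have hD : ∀ᶠ z in 𝓝 (0 : ℂ), c z * (1 + s z ^ 3) ≠ 0 := by
    have hcont : ContinuousAt (fun z => c z * (1 + s z ^ 3)) 0 :=
      ((hc.mul ((hs.pow 3).const_add 1)).differentiableAt hball).continuousAt
    exact hcont.eventually_ne (by simp [hc0, hs0])
  have hfreq : ∃ᶠ z in 𝓝[≠] (0 : ℂ), (c (2 * z), s (2 * z)) =
      ((c z ^ 3 - s z ^ 3) / (c z * (1 + s z ^ 3)),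
        s z * (1 + c z ^ 3) / (c z * (1 + s z ^ 3))) := by
    refine frequently_eq_of_hasDerivAt_vectorField
      (v := fun p : ℂ × ℂ => (-2 * p.2 ^ 2, 2 * p.1 ^ 2)) (by fun_prop) ?_ ?_
      (by simp [hc0, hs0])
    · filter_upwards [hball] with z hz
      exact (hc2_deriv z hz).prodMk (hs2_deriv z hz)
    · filter_upwards [hball, hD] with z hz hDz
      obtain ⟨h₁, h₂⟩ := dixon_duplication_hasDerivAt (hderiv z (hsub hz)).1
        (hderiv z (hsub hz)).2 (hcube z (hsub hz)) hDz
      exact h₁.prodMk h₂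
  have hfreq' : ∃ᶠ z in 𝓝[≠] (0 : ℂ),
      s (2 * z) * (c z * (1 + s z ^ 3)) = s z * (1 + c z ^ 3) ∧
      c (2 * z) * (c z * (1 + s z ^ 3)) = c z ^ 3 - s z ^ 3 := by
    refine (hfreq.and_eventually (hD.filter_mono nhdsWithin_le_nhds)).mono ?_
    rintro z ⟨heq, hDz⟩
    rw [Prod.mk.injEq, eq_div_iff hDz, eq_div_iff hDz] at heq
    exact heq.symm
  have identity {f g : ℂ → ℂ} (hf : DifferentiableOn ℂ f (ball 0 r))
      (hg : DifferentiableOn ℂ g (ball 0 r)) (hfg : ∃ᶠ z in 𝓝[≠] (0 : ℂ), f z = g z) :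
      EqOn f g (ball 0 r) :=
    (hf.analyticOnNhd isOpen_ball).eqOn_of_preconnected_of_frequently_eq
      (hg.analyticOnNhd isOpen_ball) (convex_ball _ _).isPreconnected (mem_ball_self hr0) hfg
  have hdenom := hc.mul ((hs.pow 3).const_add 1)
  intro z hz
  have hs_dup : s (2 * z) * (c z * (1 + s z ^ 3)) = s z * (1 + c z ^ 3) :=
    identity (hs2.mul hdenom) (hs.mul ((hc.pow 3).const_add 1))
      (hfreq'.mono fun _ h => h.1) hz
  have hc_dup : c (2 * z) * (c z * (1 + s z ^ 3)) = c z ^ 3 - s z ^ 3 :=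
    identity (hc2.mul hdenom) ((hc.pow 3).sub (hs.pow 3)) (hfreq'.mono fun _ h => h.2) hz
  refine ⟨fun h0 => ?_, hs_dup, hc_dup⟩
  have h := hcube z (hsub hz)
  rw [h0, mul_zero] at hc_dup
  have hc3 : c z ^ 3 = 1 / 2 := by linear_combination (h - hc_dup) / 2
  have hs3 : s z ^ 3 = 1 / 2 := by linear_combination (h + hc_dup) / 2
  rcases mul_eq_zero.1 h0 with hcz | hsz
  · norm_num [hcz] at hc3
  · norm_num [hs3] at hsz
end

section
/- Let (c, s) solve the initial value problem IVP on the open disc B_{2r}(0) with r = 2^(-2/3). Then 0 is the only zero of s in B_{2r}(0): if z in B_{2r}(0) satisfies s(z) = 0 then z = 0. -/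
open Complex Metric Set

/-- The elementary inequality behind the supersolution `t ↦ (11/10) * (4 * t / (4 - t ^ 3))`
of `y' = (1 + y ^ 3) ^ (2 / 3)`, with `x = t ^ 3`. -/
lemma barrier_polynomial_lt {x : ℝ} (hx0 : 0 ≤ x) (hx2 : x < 2) :
    ((4 - x) ^ 3 + (11 / 10) ^ 3 * 64 * x) ^ 2 < (11 / 10) ^ 3 * (16 + 8 * x) ^ 3 := by
  have h2 : 0 ≤ x ^ 2 := by positivity
  have h3 : x ^ 3 ≤ 2 * x ^ 2 := by nlinarith
  have h4 : x ^ 4 ≤ 4 * x ^ 2 := by nlinarith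
  have hx3 : 0 ≤ x ^ 3 := by positivity
  have hlow : 0 ≤ (4 - x) ^ 3 + (11 / 10) ^ 3 * 64 * x := by
    have : 0 ≤ 4 - x := by linarith
    positivity
  have hup : (4 - x) ^ 3 + (11 / 10) ^ 3 * 64 * x ≤ 64 + 38 * x + 12 * x ^ 2 := by
    nlinarith
  calc ((4 - x) ^ 3 + (11 / 10) ^ 3 * 64 * x) ^ 2 ≤ (64 + 38 * x + 12 * x ^ 2) ^ 2 := by
        gcongr
    _ < (11 / 10) ^ 3 * (16 + 8 * x) ^ 3 := by nlinarith

lemma hasDerivAt_barrier {t : ℝ} (ht : t ^ 3 < 2) :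
    HasDerivAt (fun t : ℝ => 4 * t / (4 - t ^ 3)) ((16 + 8 * t ^ 3) / (4 - t ^ 3) ^ 2) t := by
  have hd : 4 - t ^ 3 ≠ 0 := by linarith
  have h := ((hasDerivAt_id t).const_mul 4).div ((hasDerivAt_pow 3 t).const_sub 4) hd
  refine h.congr_deriv ?_
  simp only [id]
  push_cast
  field_simp
  ring

lemma hasDerivAt_integral_barrier_sq {t : ℝ} (ht : t ^ 3 < 2) :
    HasDerivAt (fun t : ℝ => 4 * t ^ 3 / (3 * (4 - t ^ 3)))
      ((4 * t / (4 - t ^ 3)) ^ 2) t := by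
  have hd : 4 - t ^ 3 ≠ 0 := by linarith
  have h := ((hasDerivAt_pow 3 t).const_mul 4).div
    (((hasDerivAt_pow 3 t).const_sub 4).const_mul 3) (mul_ne_zero three_ne_zero hd)
  refine h.congr_deriv ?_
  push_cast
  field_simp
  ring

lemma norm_le_of_hasDerivAt_lt_boundary {E : Type*} [NormedAddCommGroup E] [NormedSpace ℝ E]
    {f f' : ℝ → E} {B B' : ℝ → ℝ} {a b : ℝ}
    (hf : ∀ t ∈ Icc a b, HasDerivAt f (f' t) t) (hB : ∀ t ∈ Icc a b, HasDerivAt B (B' t) t)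
    (ha : ‖f a‖ ≤ B a) (bound : ∀ t ∈ Icc a b, ‖f t‖ = B t → ‖f' t‖ < B' t) :
    ∀ t ∈ Icc a b, ‖f t‖ ≤ B t :=
  image_norm_le_of_norm_deriv_right_lt_deriv_boundary'
    (fun t ht => (hf t ht).continuousAt.continuousWithinAt)
    (fun t ht => (hf t (Ico_subset_Icc_self ht)).hasDerivWithinAt) ha
    (fun t ht => (hB t ht).continuousAt.continuousWithinAt)
    (fun t ht => (hB t (Ico_subset_Icc_self ht)).hasDerivWithinAt)
    (fun t ht => bound t (Ico_subset_Icc_self ht))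

lemma norm_le_of_hasDerivAt_le {E : Type*} [NormedAddCommGroup E] [NormedSpace ℝ E]
    {f f' : ℝ → E} {B B' : ℝ → ℝ} {a b : ℝ}
    (hf : ∀ t ∈ Icc a b, HasDerivAt f (f' t) t) (hB : ∀ t ∈ Icc a b, HasDerivAt B (B' t) t)
    (ha : ‖f a‖ ≤ B a) (bound : ∀ t ∈ Icc a b, ‖f' t‖ ≤ B' t) :
    ∀ t ∈ Icc a b, ‖f t‖ ≤ B t :=
  image_norm_le_of_norm_deriv_right_le_deriv_boundary'
    (fun t ht => (hf t ht).continuousAt.continuousWithinAt)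
    (fun t ht => (hf t (Ico_subset_Icc_self ht)).hasDerivWithinAt) ha
    (fun t ht => (hB t ht).continuousAt.continuousWithinAt)
    (fun t ht => (hB t (Ico_subset_Icc_self ht)).hasDerivWithinAt)
    (fun t ht => bound t (Ico_subset_Icc_self ht))

section Ray

variable {f g : ℝ → ℂ} {u : ℂ} {T : ℝ}

lemma cube_add_cube_eq_one_on_ray (hf0 : f 0 = 1) (hg0 : g 0 = 0)
    (hf : ∀ t ∈ Icc 0 T, HasDerivAt f (-(g t) ^ 2 * u) t)
    (hg : ∀ t ∈ Icc 0 T, HasDerivAt g ((f t) ^ 2 * u) t) :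
    ∀ t ∈ Icc 0 T, f t ^ 3 + g t ^ 3 = 1 := by
  have hd : ∀ t ∈ Icc 0 T, HasDerivAt (fun t => f t ^ 3 + g t ^ 3) 0 t := by
    intro t ht
    refine (((hf t ht).pow 3).add ((hg t ht).pow 3)).congr_deriv ?_
    push_cast
    ring
  intro t ht
  have h := constant_of_has_deriv_right_zero
    (fun t ht => (hd t ht).continuousAt.continuousWithinAt)
    (fun t ht => (hd t (Ico_subset_Icc_self ht)).hasDerivWithinAt) t ht
  simpa [hf0, hg0] using h

lemma norm_le_barrier_on_ray (hu : ‖u‖ = 1) (hT : T ^ 3 < 2) (hf0 : f 0 = 1) (hg0 : g 0 = 0)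
    (hf : ∀ t ∈ Icc 0 T, HasDerivAt f (-(g t) ^ 2 * u) t)
    (hg : ∀ t ∈ Icc 0 T, HasDerivAt g ((f t) ^ 2 * u) t) :
    ∀ t ∈ Icc 0 T, ‖g t‖ ≤ 11 / 10 * (4 * t / (4 - t ^ 3)) := by
  have hlt : ∀ t ∈ Icc 0 T, t ^ 3 < 2 := fun t ht => (pow_le_pow_left₀ ht.1 ht.2 3).trans_lt hT
  refine norm_le_of_hasDerivAt_lt_boundary hg
    (fun t ht => (hasDerivAt_barrier (hlt t ht)).const_mul (11 / 10)) (by simp [hg0]) ?_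
  intro t ht hgt
  have hx0 : 0 ≤ t ^ 3 := pow_nonneg ht.1 3
  have hd : 0 < 4 - t ^ 3 := by linarith [hlt t ht]
  have hN : ‖f t‖ ^ 3 ≤ 1 + ‖g t‖ ^ 3 := by
    have h : f t ^ 3 = 1 - g t ^ 3 :=
      eq_sub_of_add_eq (cube_add_cube_eq_one_on_ray hf0 hg0 hf hg t ht)
    rw [← norm_pow, ← norm_pow, h]
    simpa only [norm_one] using norm_sub_le (1 : ℂ) (g t ^ 3)
  rw [norm_mul, hu, mul_one, norm_pow]
  refine lt_of_pow_lt_pow_left₀ 3 (by positivity) ?_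
  calc (‖f t‖ ^ 2) ^ 3 = (‖f t‖ ^ 3) ^ 2 := by ring
    _ ≤ (1 + ‖g t‖ ^ 3) ^ 2 := by gcongr
    _ = ((4 - t ^ 3) ^ 3 + (11 / 10) ^ 3 * 64 * t ^ 3) ^ 2 / (4 - t ^ 3) ^ 6 := by
        rw [hgt]
        field_simp
        ring
    _ < (11 / 10) ^ 3 * (16 + 8 * t ^ 3) ^ 3 / (4 - t ^ 3) ^ 6 := by
        gcongr
        exact barrier_polynomial_lt hx0 (hlt t ht)
    _ = (11 / 10 * ((16 + 8 * t ^ 3) / (4 - t ^ 3) ^ 2)) ^ 3 := by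
        field_simp

lemma norm_sub_one_le_on_ray (hu : ‖u‖ = 1) (hT : T ^ 3 < 2) (hf0 : f 0 = 1) (hg0 : g 0 = 0)
    (hf : ∀ t ∈ Icc 0 T, HasDerivAt f (-(g t) ^ 2 * u) t)
    (hg : ∀ t ∈ Icc 0 T, HasDerivAt g ((f t) ^ 2 * u) t) :
    ∀ t ∈ Icc 0 T, ‖f t - 1‖ ≤ (11 / 10) ^ 2 * (4 * t ^ 3 / (3 * (4 - t ^ 3))) := by
  have hlt : ∀ t ∈ Icc 0 T, t ^ 3 < 2 := fun t ht => (pow_le_pow_left₀ ht.1 ht.2 3).trans_lt hT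
  refine norm_le_of_hasDerivAt_le (fun t ht => (hf t ht).sub_const 1)
    (fun t ht => (hasDerivAt_integral_barrier_sq (hlt t ht)).const_mul ((11 / 10) ^ 2))
    (by simp [hf0]) ?_
  intro t ht
  rw [norm_mul, hu, mul_one, norm_neg, norm_pow, ← mul_pow]
  gcongr
  exact norm_le_barrier_on_ray hu hT hf0 hg0 hf hg t ht

lemma norm_sub_mul_le_on_ray (hu : ‖u‖ = 1) (hT : T ^ 3 < 2) (hf0 : f 0 = 1) (hg0 : g 0 = 0)
    (hf : ∀ t ∈ Icc 0 T, HasDerivAt f (-(g t) ^ 2 * u) t)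
    (hg : ∀ t ∈ Icc 0 T, HasDerivAt g ((f t) ^ 2 * u) t) :
    ∀ t ∈ Icc 0 T, ‖g t - t * u‖ ≤ 4 * t / (4 - t ^ 3) - t := by
  have hlt : ∀ t ∈ Icc 0 T, t ^ 3 < 2 := fun t ht => (pow_le_pow_left₀ ht.1 ht.2 3).trans_lt hT
  have hlin (t : ℝ) : HasDerivAt (fun t : ℝ => (t : ℂ) * u) u t := by
    simpa using (hasDerivAt_id (t : ℂ)).comp_ofReal.mul_const u
  refine norm_le_of_hasDerivAt_le (fun t ht => (hg t ht).sub (hlin t))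
    (fun t ht => (hasDerivAt_barrier (hlt t ht)).sub (hasDerivAt_id t))
    (by simp [hg0]) ?_
  intro t ht
  have hx0 : 0 ≤ t ^ 3 := pow_nonneg ht.1 3
  have hx2 := hlt t ht
  have hd : 0 < 4 - t ^ 3 := by linarith
  have hD := norm_sub_one_le_on_ray hu hT hf0 hg0 hf hg t ht
  set D := (11 / 10 : ℝ) ^ 2 * (4 * t ^ 3 / (3 * (4 - t ^ 3))) with hDdef
  have hfac : f t ^ 2 * u - u = ((f t - 1) ^ 2 + 2 * (f t - 1)) * u := by ring
  rw [hfac, norm_mul, hu, mul_one]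
  calc ‖(f t - 1) ^ 2 + 2 * (f t - 1)‖ ≤ ‖f t - 1‖ ^ 2 + 2 * ‖f t - 1‖ := by
        refine (norm_add_le _ _).trans_eq ?_
        simp
    _ ≤ D ^ 2 + 2 * D := by gcongr
    _ = (1 + D) ^ 2 - 1 := by ring
    _ = (4 - t ^ 3 + (11 / 10) ^ 2 * 4 / 3 * t ^ 3) ^ 2 / (4 - t ^ 3) ^ 2 - 1 := by
        rw [hDdef]
        field_simp
    _ ≤ (16 + 8 * t ^ 3) / (4 - t ^ 3) ^ 2 - 1 := by
        gcongr
        nlinarith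

end Ray

/-- If `(c, s)` solves the IVP on `B_{2r}(0)`, `r = 2^(-2/3)`, then
`0` is the only zero of `s` in `B_{2r}(0)`. -/
theorem dixon_unique_zero (r : ℝ) (hr : r = (2:ℝ) ^ (-(2/3) : ℝ)) (c s : ℂ → ℂ)
    (hc0 : c 0 = 1) (hs0 : s 0 = 0)
    (hderiv : ∀ z ∈ Metric.ball (0:ℂ) (2 * r),
      HasDerivAt c (-(s z) ^ 2) z ∧ HasDerivAt s ((c z) ^ 2) z) :
    ∀ z ∈ Metric.ball (0:ℂ) (2 * r), s z = 0 → z = 0 := by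
  intro z hz hsz
  by_contra hz0
  have hpos : 0 < ‖z‖ := norm_pos_iff.mpr hz0
  have hzr : ‖z‖ < 2 * r := mem_ball_zero_iff.mp hz
  have hr3 : (2 * r) ^ 3 = 2 := by
    have h : r ^ 3 = (2 : ℝ) ^ (-2 : ℝ) := by
      rw [hr, ← Real.rpow_natCast, ← Real.rpow_mul (by norm_num)]
      norm_num
    rw [mul_pow, h, Real.rpow_neg (by norm_num)]
    norm_num
  have hT : ‖z‖ ^ 3 < 2 := hr3 ▸ pow_lt_pow_left₀ hzr hpos.le three_ne_zero
  set u : ℂ := z / ‖z‖ with hu_def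
  have hu : ‖u‖ = 1 := by simp [hu_def, hz0]
  have hTu : (‖z‖ : ℂ) * u = z := mul_div_cancel₀ z (by simpa using hz0)
  have hmem : ∀ t ∈ Icc 0 ‖z‖, (t : ℂ) * u ∈ ball (0 : ℂ) (2 * r) := by
    intro t ht
    rw [mem_ball_zero_iff, norm_mul, hu, mul_one, norm_real, Real.norm_of_nonneg ht.1]
    exact ht.2.trans_lt hzr
  have hray {h : ℂ → ℂ} {h' : ℂ} {t : ℝ} (hh : HasDerivAt h h' (t * u)) :
      HasDerivAt (fun t : ℝ => h (t * u)) (h' * u) t := by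
    have hlin : HasDerivAt (fun w : ℂ => w * u) u t := by
      simpa using (hasDerivAt_id (t : ℂ)).mul_const u
    exact (HasDerivAt.comp (t : ℂ) hh hlin).comp_ofReal
  have hbound := norm_sub_mul_le_on_ray (f := fun t : ℝ => c (t * u))
    (g := fun t : ℝ => s (t * u)) hu hT (by simp [hc0]) (by simp [hs0])
    (fun t ht => hray (hderiv _ (hmem t ht)).1) (fun t ht => hray (hderiv _ (hmem t ht)).2)
    ‖z‖ (right_mem_Icc.mpr hpos.le)
  simp only [hTu, hsz, zero_sub, norm_neg] at hbound
  have hlt : 4 * ‖z‖ / (4 - ‖z‖ ^ 3) < 2 * ‖z‖ := by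
    rw [div_lt_iff₀ (by linarith)]
    nlinarith
  linarith
end

section
/- Let (c, s) solve the initial value problem IVP on the open disc B_{2r}(0) with r = 2^(-2/3). Then the function taking a real number t in the open interval (-2r, 2r) to the real part of s(t) is strictly increasing (and s is real-valued on this interval), and there exists a unique real number K in the open interval (0, 2) such that s(-K/2) = -1. -/
open Complex Metric Set

/-- Two solutions on an open interval of an autonomous `C¹` ordinary differential equation that
agree at one point agree on the whole interval. -/
theorem eqOn_Ioo_of_hasDerivAt_contDiff {E : Type*} [NormedAddCommGroup E] [NormedSpace ℝ E]
    {v : E → E} (hv : ContDiff ℝ 1 v) {f g : ℝ → E} {a b t₀ : ℝ} (ht₀ : t₀ ∈ Ioo a b)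
    (hf : ∀ t ∈ Ioo a b, HasDerivAt f (v (f t)) t)
    (hg : ∀ t ∈ Ioo a b, HasDerivAt g (v (g t)) t) (h : f t₀ = g t₀) :
    EqOn f g (Ioo a b) := by
  intro t ht
  obtain ⟨a', ha, ha'⟩ := exists_between (lt_min ht₀.1 ht.1)
  obtain ⟨b', hb', hb⟩ := exists_between (max_lt ht₀.2 ht.2)
  have hsub : Icc a' b' ⊆ Ioo a b := fun x hx => ⟨ha.trans_le hx.1, hx.2.trans_lt hb⟩
  have hcomp : IsCompact (f '' Icc a' b' ∪ g '' Icc a' b') :=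
    (isCompact_Icc.image_of_continuousOn
      (HasDerivAt.continuousOn fun x hx => hf x (hsub hx))).union
    (isCompact_Icc.image_of_continuousOn
      (HasDerivAt.continuousOn fun x hx => hg x (hsub hx)))
  obtain ⟨K, hK⟩ := (hv.locallyLipschitz.locallyLipschitzOn
    (s := f '' Icc a' b' ∪ g '' Icc a' b')).exists_lipschitzOnWith_of_compact hcomp
  refine ODE_solution_unique_of_mem_Ioo (v := fun _ => v) (fun _ _ => hK)
    (t₀ := t₀) (a := a') (b := b') ⟨ha'.trans_le (min_le_left _ _), (le_max_left _ _).trans_lt hb'⟩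
    (fun x hx => ⟨hf x (hsub (Ioo_subset_Icc_self hx)),
      Or.inl (mem_image_of_mem _ (Ioo_subset_Icc_self hx))⟩)
    (fun x hx => ⟨hg x (hsub (Ioo_subset_Icc_self hx)),
      Or.inr (mem_image_of_mem _ (Ioo_subset_Icc_self hx))⟩) h
    ⟨ha'.trans_le (min_le_right _ _), (le_max_right _ _).trans_lt hb'⟩

/-- A solution on a real interval of the complexified Dixon system with real initial values is
real-valued. -/
theorem dixon_im_eq_zero {c s : ℝ → ℂ} {R : ℝ} (hR : 0 < R) (hc0 : c 0 = 1) (hs0 : s 0 = 0)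
    (hc : ∀ t ∈ Ioo (-R) R, HasDerivAt c (-(s t) ^ 2) t)
    (hs : ∀ t ∈ Ioo (-R) R, HasDerivAt s ((c t) ^ 2) t) {t : ℝ} (ht : t ∈ Ioo (-R) R) :
    (c t).im = 0 ∧ (s t).im = 0 := by
  have hv : ContDiff ℝ 1 (fun p : ℂ × ℂ => (-p.2 ^ 2, p.1 ^ 2)) := by fun_prop
  have key := eqOn_Ioo_of_hasDerivAt_contDiff hv
    (f := fun t => (c t, s t)) (g := fun t => (starRingEnd ℂ (c t), starRingEnd ℂ (s t)))
    (a := -R) (b := R) (t₀ := 0) ⟨by linarith, hR⟩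
    (fun x hx => (hc x hx).prodMk (hs x hx))
    (fun x hx => by
      have h₁ := (Complex.conjCLE.toContinuousLinearMap.hasFDerivAt).comp_hasDerivAt x (hc x hx)
      have h₂ := (Complex.conjCLE.toContinuousLinearMap.hasFDerivAt).comp_hasDerivAt x (hs x hx)
      have h := h₁.prodMk h₂
      simpa [Function.comp_def] using h)
    (by simp [hc0, hs0]) ht
  simp only [Prod.mk.injEq] at key
  exact ⟨Complex.conj_eq_iff_im.1 key.1.symm, Complex.conj_eq_iff_im.1 key.2.symm⟩

section RealDixon

variable {u v : ℝ → ℝ} {R : ℝ}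

/-- The sine component of a real Dixon system with `(u, v) 0 = (1, 0)` is strictly increasing. -/
theorem strictMonoOn_of_dixon (hR : 0 < R) (hu0 : u 0 = 1)
    (hu : ∀ t ∈ Ioo (-R) R, HasDerivAt u (-(v t) ^ 2) t)
    (hv : ∀ t ∈ Ioo (-R) R, HasDerivAt v ((u t) ^ 2) t) :
    StrictMonoOn v (Ioo (-R) R) := by
  have hmono : MonotoneOn v (Ioo (-R) R) := by
    refine monotoneOn_of_deriv_nonneg (convex_Ioo _ _) (HasDerivAt.continuousOn hv) ?_ ?_
    · rw [interior_Ioo]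
      exact fun t ht => (hv t ht).differentiableAt.differentiableWithinAt
    · rw [interior_Ioo]
      intro t ht
      rw [(hv t ht).deriv]
      positivity
  have hne : ∀ t ∈ Ioo (-R) R, ¬ (u t = 0 ∧ v t = 0) := by
    rintro t ht ⟨hut, hvt⟩
    have hF : ContDiff ℝ 1 (fun p : ℝ × ℝ => (-p.2 ^ 2, p.1 ^ 2)) := by fun_prop
    have h0 : (0 : ℝ) ∈ Ioo (-R) R := ⟨by linarith, hR⟩
    have key := eqOn_Ioo_of_hasDerivAt_contDiff hF
      (f := fun t => (u t, v t)) (g := fun _ => (0, 0)) ht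
      (fun x hx => (hu x hx).prodMk (hv x hx))
      (fun x _ => by simpa [← Prod.zero_eq_mk] using hasDerivAt_const x (0 : ℝ × ℝ))
      (by simp [hut, hvt]) h0
    simp [hu0] at key
  intro a ha b hb hab
  refine (hmono ha hb hab.le).lt_of_ne fun heq => ?_
  have hsub : Ioo a b ⊆ Ioo (-R) R := Ioo_subset_Ioo ha.1.le hb.2.le
  have hu_zero : ∀ t ∈ Ioo a b, u t = 0 := by
    intro t ht
    have hconst : v =ᶠ[nhds t] fun _ => v a := by
      filter_upwards [Ioo_mem_nhds ht.1 ht.2] with x hx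
      exact le_antisymm ((hmono (hsub hx) hb hx.2.le).trans heq.ge)
        (hmono ha (hsub hx) hx.1.le)
    have := (hv t (hsub ht)).unique ((hasDerivAt_const t (v a)).congr_of_eventuallyEq hconst)
    simpa using this
  obtain ⟨t, ht⟩ := exists_between hab
  have ht' : t ∈ Ioo a b := ht
  have hloc : u =ᶠ[nhds t] fun _ => 0 := by
    filter_upwards [Ioo_mem_nhds ht.1 ht.2] with x hx using hu_zero x hx
  have := (hu t (hsub ht')).unique ((hasDerivAt_const t (0 : ℝ)).congr_of_eventuallyEq hloc)
  exact hne t (hsub ht') ⟨hu_zero t ht', by simpa using this⟩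

/-- The sine component of a real Dixon system with `(u, v) 0 = (1, 0)`, defined on an interval
containing `[-1, 0]`, takes the value `-1` inside `(-1, 0)`. -/
theorem exists_dixon_eq_neg_one (hR : 1 < R) (hu0 : u 0 = 1) (hv0 : v 0 = 0)
    (hu : ∀ t ∈ Ioo (-R) R, HasDerivAt u (-(v t) ^ 2) t)
    (hv : ∀ t ∈ Ioo (-R) R, HasDerivAt v ((u t) ^ 2) t) :
    ∃ t ∈ Ioo (-1 : ℝ) 0, v t = -1 := by
  have hsub : Icc (-1 : ℝ) 0 ⊆ Ioo (-R) R := fun x hx =>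
    ⟨by linarith [hx.1], by linarith [hx.2]⟩
  have h0 : (0 : ℝ) ∈ Ioo (-R) R := hsub ⟨by norm_num, le_rfl⟩
  have hvc : ContinuousOn v (Icc (-1) 0) :=
    HasDerivAt.continuousOn fun t ht => hv t (hsub ht)
  have huc : ContinuousOn u (Icc (-1) 0) :=
    HasDerivAt.continuousOn fun t ht => hu t (hsub ht)
  have hvneg : ∀ t ∈ Ioo (-1 : ℝ) 0, v t < 0 := fun t ht =>
    hv0 ▸ strictMonoOn_of_dixon (by linarith) hu0 hu hv (hsub (Ioo_subset_Icc_self ht)) h0 ht.2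
  have hanti : StrictAntiOn u (Icc (-1) 0) := by
    refine strictAntiOn_of_deriv_neg (convex_Icc _ _) huc fun t ht => ?_
    rw [interior_Icc] at ht
    rw [(hu t (hsub (Ioo_subset_Icc_self ht))).deriv]
    have := hvneg t ht
    nlinarith
  have hmono : StrictMonoOn (fun t => v t - t) (Icc (-1) 0) := by
    refine strictMonoOn_of_deriv_pos (convex_Icc _ _) (hvc.sub continuousOn_id) fun t ht => ?_
    rw [interior_Icc] at ht
    have hd : HasDerivAt (fun t => v t - t) (u t ^ 2 - 1) t :=
      (hv t (hsub (Ioo_subset_Icc_self ht))).sub (hasDerivAt_id' t)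
    rw [hd.deriv]
    have := hanti (Ioo_subset_Icc_self ht) (right_mem_Icc.2 (by norm_num)) ht.2
    nlinarith
  have h1 : v (-1) < -1 := by
    have := hmono (left_mem_Icc.2 (by norm_num)) (right_mem_Icc.2 (by norm_num))
      (by norm_num : (-1 : ℝ) < 0)
    simp only [hv0] at this
    linarith
  exact intermediate_value_Ioo (by norm_num) hvc ⟨h1, by rw [hv0]; norm_num⟩

end RealDixon

/-- If `(c, s)` solves the IVP on `B_{2r}(0)`, `r = 2^(-2/3)`, then
`t ↦ (s t).re` is strictly increasing on `(-2r, 2r)` (and `s` is real-valued there),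
and there is a unique `K ∈ (0, 2)` with `s (-K/2) = -1`. -/
theorem dixon_K_exists (r : ℝ) (hr : r = (2:ℝ) ^ (-(2/3) : ℝ)) (c s : ℂ → ℂ)
    (hc0 : c 0 = 1) (hs0 : s 0 = 0)
    (hderiv : ∀ z ∈ Metric.ball (0:ℂ) (2 * r),
      HasDerivAt c (-(s z) ^ 2) z ∧ HasDerivAt s ((c z) ^ 2) z) :
    StrictMonoOn (fun t : ℝ => (s (t : ℂ)).re) (Set.Ioo (-(2 * r)) (2 * r)) ∧
    (∀ t ∈ Set.Ioo (-(2 * r)) (2 * r), (s (t : ℂ)).im = 0) ∧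
    ∃! K : ℝ, K ∈ Set.Ioo (0:ℝ) 2 ∧ s (-(K : ℂ) / 2) = -1 := by
  have hR : 1 < 2 * r := by
    have h : (2 : ℝ) ^ (-1 : ℝ) < r := by
      rw [hr]
      exact Real.rpow_lt_rpow_of_exponent_lt (by norm_num) (by norm_num)
    rw [Real.rpow_neg_one] at h
    linarith
  have hball : ∀ t ∈ Ioo (-(2 * r)) (2 * r), (t : ℂ) ∈ Metric.ball (0 : ℂ) (2 * r) := by
    intro t ht
    rw [mem_ball_zero_iff, Complex.norm_real, Real.norm_eq_abs]
    exact abs_lt.2 ht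
  have him : ∀ t ∈ Ioo (-(2 * r)) (2 * r), (c t).im = 0 ∧ (s t).im = 0 := fun t ht =>
    dixon_im_eq_zero (c := fun t : ℝ => c t) (s := fun t : ℝ => s t) (by linarith)
      (by simpa using hc0) (by simpa using hs0)
      (fun x hx => (hderiv x (hball x hx)).1.comp_ofReal)
      (fun x hx => (hderiv x (hball x hx)).2.comp_ofReal) ht
  have hu : ∀ t ∈ Ioo (-(2 * r)) (2 * r),
      HasDerivAt (fun t : ℝ => (c t).re) (-((s t).re) ^ 2) t := by
    intro t ht
    simpa [pow_two, (him t ht).2] using (hderiv t (hball t ht)).1.real_of_complex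
  have hv : ∀ t ∈ Ioo (-(2 * r)) (2 * r),
      HasDerivAt (fun t : ℝ => (s t).re) (((c t).re) ^ 2) t := by
    intro t ht
    simpa [pow_two, (him t ht).1] using (hderiv t (hball t ht)).2.real_of_complex
  have hu0 : (c ((0 : ℝ) : ℂ)).re = 1 := by simp [hc0]
  have hv0 : (s ((0 : ℝ) : ℂ)).re = 0 := by simp [hs0]
  have hmono := strictMonoOn_of_dixon (by linarith) hu0 hu hv
  refine ⟨hmono, fun t ht => (him t ht).2, ?_⟩
  obtain ⟨t, ht, hst⟩ := exists_dixon_eq_neg_one hR hu0 hv0 hu hv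
  have htR : t ∈ Ioo (-(2 * r)) (2 * r) := ⟨by linarith [ht.1], by linarith [ht.2]⟩
  refine ⟨-2 * t, ⟨⟨by linarith [ht.2], by linarith [ht.1]⟩, ?_⟩, ?_⟩
  · have : -((-2 * t : ℝ) : ℂ) / 2 = t := by push_cast; ring
    rw [this]
    exact Complex.ext (by simpa using hst) (by simpa using (him t htR).2)
  · rintro K ⟨hK, hsK⟩
    have hcast : -(K : ℂ) / 2 = ((-K / 2 : ℝ) : ℂ) := by push_cast; ring
    rw [hcast] at hsK
    have heq : (s ((-K / 2 : ℝ) : ℂ)).re = (s t).re := by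
      rw [hsK, hst]
      simp
    have := hmono.injOn ⟨by linarith [hK.2], by linarith [hK.1]⟩ htR heq
    linarith
end

section
/- Let (c, s) be the unique solution of the initial value problem IVP on the open disc B_{2r}(0) with r = 2^(-2/3), let K be the unique real number in (0, 2) with s(-K/2) = -1, and let γ = exp(2πi/3). Then there exist holomorphic functions C, S on the set U = B_{4r}(0) \ {-K, -Kγ, -K·conj(γ)} extending c and s (i.e. agreeing with them on B_{2r}(0) minus those points) and satisfying C'(z) = -S(z)^2 and S'(z) = C(z)^2 for all z in U; moreover each point p in {-K, -Kγ, -K·conj(γ)} is a simple pole of both S and C: the function z ↦ (z - p)·S(z) tends to a nonzero finite limit as z tends to p, and likewise for C. -/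
open Complex Metric Set Filter Topology

/-- `c' = -s ^ 2` and `s' = c ^ 2` on `U`. -/
def DixonSystem (c s : ℂ → ℂ) (U : Set ℂ) : Prop :=
  ∀ z ∈ U, HasDerivAt c (-(s z) ^ 2) z ∧ HasDerivAt s ((c z) ^ 2) z

namespace DixonSystem

variable {c s C S : ℂ → ℂ} {U V : Set ℂ} {R : ℝ}

lemma mono (h : DixonSystem c s U) (hVU : V ⊆ U) : DixonSystem c s V :=
  fun z hz => h z (hVU hz)

lemma smul_mem_ball {z : ℂ} (hz : z ∈ ball (0 : ℂ) R) {t : ℝ} (ht : t ∈ Icc (0 : ℝ) 1) :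
    (t : ℂ) * z ∈ ball (0 : ℂ) R := by
  rw [mem_ball_zero_iff] at hz ⊢
  rw [norm_mul, Complex.norm_real, Real.norm_of_nonneg ht.1]
  exact (mul_le_of_le_one_left (norm_nonneg z) ht.2).trans_lt hz

lemma hasDerivAt_ray {f : ℂ → ℂ} {f' z : ℂ} {t : ℝ} (hf : HasDerivAt f f' (t * z)) :
    HasDerivAt (fun x : ℝ => f (x * z)) (f' * z) t := by
  have h1 : HasDerivAt (fun w : ℂ => w * z) z (t : ℂ) := by
    simpa using (hasDerivAt_id (t : ℂ)).mul_const z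
  exact (hf.comp (t : ℂ) h1).comp_ofReal

/-- Two solutions on a disc with the same initial values coincide. -/
lemma eqOn_ball (h : DixonSystem c s (ball 0 R)) (H : DixonSystem C S (ball 0 R))
    (hc : c 0 = C 0) (hs : s 0 = S 0) : ∀ z ∈ ball (0 : ℂ) R, c z = C z ∧ s z = S z := by
  intro z hz
  let f : ℝ → ℂ × ℂ := fun t => (c (t * z) - C (t * z), s (t * z) - S (t * z))
  let f' : ℝ → ℂ × ℂ := fun t =>
    ((-(s (t * z)) ^ 2) * z - (-(S (t * z)) ^ 2) * z, (c (t * z)) ^ 2 * z - (C (t * z)) ^ 2 * z)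
  let g : ℝ → ℂ × ℂ := fun t => ((s (t * z) + S (t * z)) * z, (c (t * z) + C (t * z)) * z)
  have hd : ∀ t ∈ Icc (0 : ℝ) 1, HasDerivAt f (f' t) t := fun t ht => by
    have h1 := h _ (smul_mem_ball hz ht)
    have h2 := H _ (smul_mem_ball hz ht)
    exact ((hasDerivAt_ray h1.1).sub (hasDerivAt_ray h2.1)).prodMk
      ((hasDerivAt_ray h1.2).sub (hasDerivAt_ray h2.2))
  have hg : ContinuousOn g (Icc 0 1) := fun t ht => by
    have h1 := h _ (smul_mem_ball hz ht)
    have h2 := H _ (smul_mem_ball hz ht)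
    exact ((((hasDerivAt_ray h1.2).add (hasDerivAt_ray h2.2)).continuousAt.mul
      continuousAt_const).prodMk (((hasDerivAt_ray h1.1).add
      (hasDerivAt_ray h2.1)).continuousAt.mul continuousAt_const)).continuousWithinAt
  obtain ⟨M, hM⟩ := isCompact_Icc.exists_bound_of_continuousOn hg
  have hzero := eq_zero_of_abs_deriv_le_mul_abs_self_of_eq_zero_right (f := f) (f' := f') (K := M)
    (fun t ht => (hd t ht).continuousAt.continuousWithinAt)
    (fun t ht => (hd t (Ico_subset_Icc_self ht)).hasDerivWithinAt) (by simp [f, hc, hs])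
    (fun t ht => by
      have hb := hM t (Ico_subset_Icc_self ht)
      rw [Prod.norm_def, sup_le_iff] at hb
      have e1 : (f' t).1 = -((g t).1 * (f t).2) := by simp only [f, f', g]; ring
      have e2 : (f' t).2 = (g t).2 * (f t).1 := by simp only [f, f', g]; ring
      rw [Prod.norm_def, sup_le_iff, e1, e2, norm_neg, norm_mul (g t).1,
        norm_mul (g t).2]
      exact ⟨mul_le_mul hb.1 (norm_snd_le _) (norm_nonneg _) ((norm_nonneg _).trans hb.1),
        mul_le_mul hb.2 (norm_fst_le _) (norm_nonneg _) ((norm_nonneg _).trans hb.1)⟩)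
    1 (right_mem_Icc.2 zero_le_one)
  simpa [f, sub_eq_zero] using hzero

/-- The conserved quantity `c ^ 3 + s ^ 3`. -/
lemma cube_add_cube (h : DixonSystem c s (ball 0 R)) (hc : c 0 = 1) (hs : s 0 = 0) :
    ∀ z ∈ ball (0 : ℂ) R, c z ^ 3 + s z ^ 3 = 1 := by
  intro z hz
  have h0 : (0 : ℂ) ∈ ball (0 : ℂ) R := mem_ball_self (pos_of_mem_ball hz)
  have hd : ∀ w ∈ ball (0 : ℂ) R,
      HasDerivWithinAt (fun w => c w ^ 3 + s w ^ 3) 0 (ball 0 R) w := fun w hw => by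
    have := ((h w hw).1.pow 3).add ((h w hw).2.pow 3)
    refine HasDerivAt.hasDerivWithinAt (this.congr_deriv ?_)
    push_cast
    ring
  have := (convex_ball (0 : ℂ) R).norm_image_sub_le_of_norm_hasDerivWithin_le hd
    (C := 0) (by simp) h0 hz
  simpa [hc, hs, sub_eq_zero] using this

/-- Equivariance under multiplication by a cube root of unity. -/
lemma rotate (h : DixonSystem c s (ball 0 R)) (hs : s 0 = 0) {ω : ℂ}
    (hω : ω ^ 3 = 1) : ∀ z ∈ ball (0 : ℂ) R, c (ω * z) = c z ∧ s (ω * z) = ω * s z := by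
  intro z hz
  have hn : ‖ω‖ = 1 := norm_eq_one_of_pow_eq_one hω three_ne_zero
  have H : DixonSystem (fun z => c (ω * z)) (fun z => ω ^ 2 * s (ω * z)) (ball 0 R) := by
    intro w hw
    have hw' : ω * w ∈ ball (0 : ℂ) R := by simpa [hn] using hw
    have hm : HasDerivAt (fun z : ℂ => ω * z) ω w := by
      simpa using (hasDerivAt_id w).const_mul ω
    refine ⟨((h _ hw').1.comp w hm).congr_deriv ?_,
      (((h _ hw').2.comp w hm).const_mul (ω ^ 2)).congr_deriv ?_⟩
    · linear_combination ω * s (ω * w) ^ 2 * hω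
    · linear_combination c (ω * w) ^ 2 * hω
  obtain ⟨h1, h2⟩ := h.eqOn_ball H (by simp) (by simp [hs]) z hz
  refine ⟨h1.symm, ?_⟩
  rw [h2]
  linear_combination (-s (ω * z)) * hω

/-- A priori bound by comparison with `t ↦ 1.02 t + t ^ 4 / 4` along rays. -/
lemma norm_cube_le (h : DixonSystem c s (ball 0 R)) (hc : c 0 = 1) (hs : s 0 = 0)
    (hR : R ^ 3 ≤ 1 / 4) : ∀ z ∈ ball (0 : ℂ) R, ‖s z‖ ^ 3 ≤ 1 / 3 := by
  intro z hz
  rcases eq_or_ne z 0 with rfl | hz0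
  · norm_num [hs]
  have hρ : 0 < ‖z‖ := norm_pos_iff.2 hz0
  have hρ3 : ‖z‖ ^ 3 ≤ 1 / 4 :=
    (pow_le_pow_left₀ hρ.le (mem_ball_zero_iff.1 hz).le 3).trans hR
  have hcomp : ∀ x : ℝ, 0 ≤ x → x ≤ 1 / 4 → x * (51 / 50 + x / 4) ^ 3 ≤ 127 / 100 * x := by
    intro x hx0 hx
    have : (51 / 50 + x / 4) ^ 3 ≤ (51 / 50 + (1 / 4) / 4 : ℝ) ^ 3 := by gcongr
    nlinarith
  have key := image_norm_le_of_norm_deriv_right_lt_deriv_boundary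
    (f := fun t : ℝ => s (t * z)) (f' := fun t : ℝ => c (t * z) ^ 2 * z) (a := 0) (b := 1)
    (B := fun t => ‖z‖ * t * (51 / 50 + (‖z‖ * t) ^ 3 / 4))
    (B' := fun t => (51 / 50 + (‖z‖ * t) ^ 3) * ‖z‖)
    (fun t ht => (hasDerivAt_ray (h _ (smul_mem_ball hz ht)).2).continuousAt.continuousWithinAt)
    (fun t ht => (hasDerivAt_ray
      (h _ (smul_mem_ball hz (Ico_subset_Icc_self ht))).2).hasDerivWithinAt)
    (by simp [hs])
    (fun t => by
      have h1 : HasDerivAt (fun t : ℝ => ‖z‖ * t) ‖z‖ t := by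
        simpa using (hasDerivAt_id t).const_mul ‖z‖
      refine (h1.mul (((h1.pow 3).div_const 4).const_add (51 / 50))).congr_deriv ?_
      simp only [Pi.pow_apply]
      push_cast
      ring)
    (fun t ht hB => by
      simp only [norm_mul, norm_pow]
      refine mul_lt_mul_of_pos_right ?_ hρ
      have ht0 : 0 ≤ ‖z‖ * t := mul_nonneg hρ.le ht.1
      have hx : (‖z‖ * t) ^ 3 ≤ 1 / 4 := by
        refine le_trans (pow_le_pow_left₀ ht0 ?_ 3) hρ3
        exact mul_le_of_le_one_right hρ.le ht.2.le
      have hx0 : 0 ≤ (‖z‖ * t) ^ 3 := by positivity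
      have hs3 : ‖s (t * z)‖ ^ 3 ≤ 127 / 100 * (‖z‖ * t) ^ 3 := by
        rw [hB, mul_pow]
        exact hcomp _ hx0 hx
      have hc3 : ‖c (t * z)‖ ^ 3 ≤ 1 + ‖s (t * z)‖ ^ 3 := by
        have := h.cube_add_cube hc hs _ (smul_mem_ball hz (Ico_subset_Icc_self ht))
        rw [← norm_pow, ← norm_pow, eq_sub_of_add_eq this]
        simpa only [norm_one] using norm_sub_le (1 : ℂ) (s (t * z) ^ 3)
      refine lt_of_pow_lt_pow_left₀ 3 (by positivity) ?_
      generalize (‖z‖ * t) ^ 3 = x at *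
      calc (‖c (t * z)‖ ^ 2) ^ 3 = (‖c (t * z)‖ ^ 3) ^ 2 := by ring
        _ ≤ (1 + 127 / 100 * x) ^ 2 := by gcongr; linarith
        _ < (51 / 50 + x) ^ 3 := by nlinarith [pow_nonneg hx0 3, pow_nonneg hx0 2])
    (right_mem_Icc.2 zero_le_one)
  simp only [ofReal_one, one_mul, mul_one] at key
  calc ‖s z‖ ^ 3 ≤ (‖z‖ * (51 / 50 + ‖z‖ ^ 3 / 4)) ^ 3 := by gcongr
    _ = ‖z‖ ^ 3 * (51 / 50 + ‖z‖ ^ 3 / 4) ^ 3 := by ring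
    _ ≤ 127 / 100 * ‖z‖ ^ 3 := hcomp _ (by positivity) hρ3
    _ ≤ 1 / 3 := by linarith

/-- `s` is injective on small discs, because `s'` is close to `1` there. -/
lemma injOn_ball (h : DixonSystem c s (ball 0 R)) (hc : c 0 = 1) (hs : s 0 = 0)
    (hR : R ^ 3 ≤ 1 / 4) : InjOn s (ball 0 R) := by
  have hR' : R ≤ 63 / 100 := by
    by_contra! hlt
    have := pow_lt_pow_left₀ hlt (by norm_num) three_ne_zero
    norm_num at this
    linarith
  have hsq : ∀ z ∈ ball (0 : ℂ) R, ‖-(s z) ^ 2‖ ≤ 49 / 100 := fun z hz => by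
    have h1 := h.norm_cube_le hc hs hR z hz
    have h2 : ‖s z‖ ≤ 7 / 10 := by
      by_contra! hlt
      have := pow_lt_pow_left₀ hlt (by norm_num) three_ne_zero
      norm_num at this
      linarith
    rw [norm_neg, norm_pow]
    nlinarith [norm_nonneg (s z)]
  have hc1 : ∀ z ∈ ball (0 : ℂ) R, ‖c z ^ 2 - 1‖ ≤ 3 / 4 := fun z hz => by
    have h0 : (0 : ℂ) ∈ ball (0 : ℂ) R := mem_ball_self (pos_of_mem_ball hz)
    have h1 := (convex_ball (0 : ℂ) R).norm_image_sub_le_of_norm_hasDerivWithin_le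
      (fun w hw => (h w hw).1.hasDerivWithinAt) hsq h0 hz
    rw [hc, sub_zero] at h1
    have hz' := mem_ball_zero_iff.1 hz
    have h2 : ‖c z - 1‖ ≤ 31 / 100 := by linarith
    have h3 : ‖c z - 1 + 2‖ ≤ 31 / 100 + 2 :=
      (norm_add_le _ _).trans (by simpa using h2)
    calc ‖c z ^ 2 - 1‖ = ‖c z - 1‖ * ‖c z - 1 + 2‖ := by rw [← norm_mul]; ring_nf
      _ ≤ 31 / 100 * (31 / 100 + 2) := by gcongr
      _ ≤ 3 / 4 := by norm_num
  intro a ha b hb hab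
  have h1 := (convex_ball (0 : ℂ) R).norm_image_sub_le_of_norm_hasDerivWithin_le
    (f := fun z => s z - z) (fun w hw => ((h w hw).2.sub (hasDerivAt_id w)).hasDerivWithinAt)
    hc1 hb ha
  simp only [hab, sub_sub_sub_cancel_left] at h1
  rw [norm_sub_rev] at h1
  have : ‖a - b‖ = 0 := by linarith [norm_nonneg (a - b)]
  exact sub_eq_zero.1 (norm_eq_zero.1 this)

/-- Common denominator of the duplication formulas. -/
def dupDen (c s : ℂ → ℂ) (u : ℂ) : ℂ := c u * (1 + s u ^ 3)

/-- Duplication formula for `c`. -/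
noncomputable def dupC (c s : ℂ → ℂ) (z : ℂ) : ℂ := (c (z / 2) ^ 3 - s (z / 2) ^ 3) / dupDen c s (z / 2)

/-- Duplication formula for `s`. -/
noncomputable def dupS (c s : ℂ → ℂ) (z : ℂ) : ℂ := s (z / 2) * (1 + c (z / 2) ^ 3) / dupDen c s (z / 2)

lemma hasDerivAt_dupDen (h : DixonSystem c s U) {u : ℂ} (hu : u ∈ U) :
    HasDerivAt (dupDen c s) (-(s u) ^ 2 * (1 + s u ^ 3) + 3 * s u ^ 2 * c u ^ 3) u := by
  refine ((h u hu).1.mul (((h u hu).2.pow 3).const_add 1)).congr_deriv ?_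
  simp only [Pi.pow_apply]
  push_cast
  ring

/-- The duplication formulas solve the same system wherever their denominator does not vanish. -/
lemma dup (h : DixonSystem c s U) (hcs : ∀ u ∈ U, c u ^ 3 + s u ^ 3 = 1) :
    DixonSystem (dupC c s) (dupS c s) {z | z / 2 ∈ U ∧ dupDen c s (z / 2) ≠ 0} := by
  rintro z ⟨hz, hD⟩
  have hh : HasDerivAt (fun z : ℂ => z / 2) (1 / 2) z := (hasDerivAt_id z).div_const 2
  have hc := (h _ hz).1
  have hs := (h _ hz).2
  have hden := (h.hasDerivAt_dupDen hz).comp z hh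
  have hnc := ((hc.pow 3).sub (hs.pow 3)).comp z hh
  have hns := (hs.mul ((hc.pow 3).const_add 1)).comp z hh
  have hid := hcs _ hz
  have hD' : c (z / 2) * (1 + s (z / 2) ^ 3) ≠ 0 := hD
  refine ⟨(hnc.div hden hD).congr_deriv ?_, (hns.div hden hD).congr_deriv ?_⟩
  · simp only [dupS, dupDen, Function.comp_apply, Pi.pow_apply, Pi.sub_apply]
    push_cast
    generalize c (z / 2) = a at *
    generalize s (z / 2) = b at *
    rw [div_pow, ← neg_div, div_left_inj' (pow_ne_zero 2 hD')]
    linear_combination (-(b ^ 2) * (a ^ 3 + b ^ 3 + 2) / 2) * hid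
  · simp only [dupC, dupDen, Function.comp_apply, Pi.pow_apply, Pi.mul_apply]
    push_cast
    generalize c (z / 2) = a at *
    generalize s (z / 2) = b at *
    rw [div_pow, div_left_inj' (pow_ne_zero 2 hD')]
    linear_combination (-(a ^ 3 + b ^ 3 + 2 * a ^ 3 * b ^ 3) / 2) * hid

lemma cube_ne {w q : ℂ} (hw : ‖w‖ ^ 3 ≤ 1 / 3) (hq : 1 / 3 < ‖q‖) : w ^ 3 ≠ q := by
  rintro rfl
  rw [norm_pow] at hq
  exact absurd hw (not_le.2 hq)

/-- The denominator does not vanish on small discs. -/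
lemma dupDen_ne_zero (h : DixonSystem c s (ball 0 R)) (hc : c 0 = 1) (hs : s 0 = 0)
    (hR : R ^ 3 ≤ 1 / 4) : ∀ u ∈ ball (0 : ℂ) R, dupDen c s u ≠ 0 := by
  intro u hu
  have hb := h.norm_cube_le hc hs hR u hu
  have hid := h.cube_add_cube hc hs u hu
  refine mul_ne_zero (fun h0 => ?_) (fun h0 => ?_)
  · exact cube_ne (q := 1) hb (by norm_num) (by rw [h0] at hid; simpa using hid)
  · exact cube_ne (q := -1) hb (by norm_num) (by linear_combination h0)

lemma half_mem_ball {z : ℂ} : z / 2 ∈ ball (0 : ℂ) R ↔ z ∈ ball (0 : ℂ) (2 * R) := by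
  rw [mem_ball_zero_iff, mem_ball_zero_iff, norm_div, Complex.norm_ofNat,
    div_lt_iff₀ two_pos, mul_comm]

lemma restrict_half (h : DixonSystem c s (ball 0 (2 * R))) : DixonSystem c s (ball 0 R) := by
  rcases le_or_gt R 0 with hR | hR
  · simp [ball_eq_empty.2 hR, DixonSystem]
  · exact h.mono (ball_subset_ball (by linarith))

/-- The duplication formulas hold on a disc of twice the radius. -/
lemma eq_dup (h : DixonSystem c s (ball 0 (2 * R))) (hc : c 0 = 1) (hs : s 0 = 0)
    (hR : R ^ 3 ≤ 1 / 4) : ∀ z ∈ ball (0 : ℂ) (2 * R), c z = dupC c s z ∧ s z = dupS c s z := by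
  have h' := h.restrict_half
  refine h.eqOn_ball ((h'.dup (h'.cube_add_cube hc hs)).mono fun z hz => ?_) ?_ ?_
  · have := half_mem_ball.2 hz
    exact ⟨this, h'.dupDen_ne_zero hc hs hR _ this⟩
  · simp [dupC, dupDen, hc, hs]
  · simp [dupS, dupDen, hs]

lemma c_ne_zero (h : DixonSystem c s (ball 0 (2 * R))) (hc : c 0 = 1) (hs : s 0 = 0)
    (hR : R ^ 3 ≤ 1 / 4) : ∀ w ∈ ball (0 : ℂ) (2 * R), c w ≠ 0 := by
  intro w hw h0
  have h' := h.restrict_half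
  have hu := half_mem_ball.2 hw
  have hD := h'.dupDen_ne_zero hc hs hR _ hu
  have hid := h'.cube_add_cube hc hs _ hu
  rw [(h.eq_dup hc hs hR w hw).1, dupC, div_eq_zero_iff, or_iff_left hD] at h0
  exact cube_ne (q := 1 / 2) (h'.norm_cube_le hc hs hR _ hu) (by norm_num)
    (by linear_combination (hid - h0) / 2)

/-- The quartic satisfied by `s (w / 2) ^ 3` when `s w ^ 3 = -1`. -/
lemma quartic_eq_zero (h : DixonSystem c s (ball 0 (2 * R))) (hc : c 0 = 1) (hs : s 0 = 0)
    (hR : R ^ 3 ≤ 1 / 4) {w : ℂ} (hw : w ∈ ball (0 : ℂ) (2 * R)) (hsw : s w ^ 3 = -1) :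
    1 + 10 * s (w / 2) ^ 3 - 12 * (s (w / 2) ^ 3) ^ 2 + 4 * (s (w / 2) ^ 3) ^ 3
      - 2 * (s (w / 2) ^ 3) ^ 4 = 0 := by
  have h' := h.restrict_half
  have hu := half_mem_ball.2 hw
  have hD := h'.dupDen_ne_zero hc hs hR _ hu
  have hid := eq_sub_of_add_eq (h'.cube_add_cube hc hs _ hu)
  rw [(h.eq_dup hc hs hR w hw).2, dupS, div_pow, div_eq_iff (pow_ne_zero 3 hD), dupDen,
    mul_pow, mul_pow, hid] at hsw
  linear_combination hsw

/-- The quartic is injective on a small disc. -/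
lemma eq_of_quartic {x y : ℂ} (hx : ‖x‖ ≤ 1 / 3) (hy : ‖y‖ ≤ 1 / 3)
    (hxy : 1 + 10 * x - 12 * x ^ 2 + 4 * x ^ 3 - 2 * x ^ 4
      = 1 + 10 * y - 12 * y ^ 2 + 4 * y ^ 3 - 2 * y ^ 4) : x = y := by
  by_contra hne
  have h1 : (10 : ℂ) = 12 * (x + y) - 4 * (x * x + x * y + y * y)
      + 2 * ((x + y) * (x * x + y * y)) := by
    refine mul_left_cancel₀ (sub_ne_zero.2 hne) ?_
    linear_combination hxy
  have hadd : ∀ {a b : ℂ} {A B : ℝ}, ‖a‖ ≤ A → ‖b‖ ≤ B → ‖a + b‖ ≤ A + B :=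
    fun ha hb => (norm_add_le _ _).trans (add_le_add ha hb)
  have hmul : ∀ {a b : ℂ} {A B : ℝ}, ‖a‖ ≤ A → ‖b‖ ≤ B → ‖a * b‖ ≤ A * B := fun ha hb =>
    (norm_mul_le _ _).trans (mul_le_mul ha hb (norm_nonneg _) ((norm_nonneg _).trans ha))
  have h2 := hadd (hadd (hmul (le_refl ‖(12 : ℂ)‖) (hadd hx hy))
      (hmul (le_refl ‖(-4 : ℂ)‖) (hadd (hadd (hmul hx hx) (hmul hx hy)) (hmul hy hy))))
    (hmul (le_refl ‖(2 : ℂ)‖) (hmul (hadd hx hy) (hadd (hmul hx hx) (hmul hy hy))))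
  rw [neg_mul, ← sub_eq_add_neg, ← h1] at h2
  norm_num at h2

/-- The points of the disc where `s ^ 3 = -1` form one orbit under rotation by cube roots of
unity. -/
lemma eq_rotate_of_cube_eq (h : DixonSystem c s (ball 0 (2 * R))) (hc : c 0 = 1) (hs : s 0 = 0)
    (hR : R ^ 3 ≤ 1 / 4) {w v : ℂ} (hw : w ∈ ball (0 : ℂ) (2 * R))
    (hv : v ∈ ball (0 : ℂ) (2 * R)) (hsw : s w ^ 3 = -1) (hsv : s v ^ 3 = -1) :
    ∃ ω : ℂ, ω ^ 3 = 1 ∧ w = ω * v := by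
  have h' := h.restrict_half
  have hu := half_mem_ball.2 hw
  have hx := half_mem_ball.2 hv
  have hu3 := h'.norm_cube_le hc hs hR _ hu
  have hx3 := h'.norm_cube_le hc hs hR _ hx
  rw [← norm_pow] at hu3 hx3
  have hq := eq_of_quartic hu3 hx3 ((h.quartic_eq_zero hc hs hR hw hsw).trans
    (h.quartic_eq_zero hc hs hR hv hsv).symm)
  have hne : s (v / 2) ≠ 0 := fun h0 => by
    have := h.quartic_eq_zero hc hs hR hv hsv
    norm_num [h0] at this
  have hω : (s (w / 2) / s (v / 2)) ^ 3 = 1 := by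
    rw [div_pow, hq, div_self (pow_ne_zero 3 hne)]
  refine ⟨s (w / 2) / s (v / 2), hω, ?_⟩
  have hrot := (h'.rotate hs hω _ hx).2
  rw [div_mul_cancel₀ _ hne] at hrot
  have hmem : s (w / 2) / s (v / 2) * (v / 2) ∈ ball (0 : ℂ) R := by
    have hn := norm_eq_one_of_pow_eq_one hω three_ne_zero
    rw [mem_ball_zero_iff] at hx ⊢
    rwa [norm_mul, hn, one_mul]
  have := h'.injOn_ball hc hs hR hmem hu hrot
  linear_combination (-2) * this

/-- The duplication formulas have simple poles at twice the points where `s ^ 3 = -1`. -/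
lemma tendsto_pole (h : DixonSystem c s (ball 0 (2 * R))) (hc : c 0 = 1) (hs : s 0 = 0)
    {p : ℂ} (hp : p / 2 ∈ ball (0 : ℂ) (2 * R)) (hsp : s (p / 2) ^ 3 = -1) :
    (∃ L : ℂ, L ≠ 0 ∧ Tendsto (fun z => (z - p) * dupS c s z) (𝓝[≠] p) (𝓝 L)) ∧
    (∃ L : ℂ, L ≠ 0 ∧ Tendsto (fun z => (z - p) * dupC c s z) (𝓝[≠] p) (𝓝 L)) := by
  have hh : HasDerivAt (fun z : ℂ => z / 2) (1 / 2) p := (hasDerivAt_id p).div_const 2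
  have hid := h.cube_add_cube hc hs _ hp
  have hc3 : c (p / 2) ^ 3 = 2 := by linear_combination hid - hsp
  have hs0 : s (p / 2) ≠ 0 := fun h0 => by norm_num [h0] at hsp
  have hden : HasDerivAt (fun z => dupDen c s (z / 2)) (3 * s (p / 2) ^ 2) p := by
    refine ((h.hasDerivAt_dupDen hp).comp p hh).congr_deriv ?_
    rw [hsp, hc3]
    ring
  have hD0 : dupDen c s (p / 2) = 0 := by rw [dupDen, hsp]; ring
  have hne : 3 * s (p / 2) ^ 2 ≠ 0 := by simpa using hs0
  have hinv : Tendsto (fun z => (z - p) / dupDen c s (z / 2)) (𝓝[≠] p)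
      (𝓝 (3 * s (p / 2) ^ 2)⁻¹) := by
    refine ((hasDerivAt_iff_tendsto_slope.1 hden).inv₀ hne).congr fun z => ?_
    rw [slope_def_field, hD0, sub_zero, inv_div]
  have hcc : ContinuousAt (fun z => c (z / 2)) p := ((h _ hp).1.comp p hh).continuousAt
  have hsc : ContinuousAt (fun z => s (z / 2)) p := ((h _ hp).2.comp p hh).continuousAt
  have hnc : ContinuousAt (fun z => c (z / 2) ^ 3 - s (z / 2) ^ 3) p := (hcc.pow 3).sub (hsc.pow 3)
  have hns : ContinuousAt (fun z => s (z / 2) * (1 + c (z / 2) ^ 3)) p :=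
    hsc.mul ((hcc.pow 3).const_add 1)
  refine ⟨⟨_, mul_ne_zero (inv_ne_zero hne) ?_,
    (hinv.mul (hns.tendsto.mono_left nhdsWithin_le_nhds)).congr fun z => ?_⟩,
    ⟨_, mul_ne_zero (inv_ne_zero hne) ?_,
    (hinv.mul (hnc.tendsto.mono_left nhdsWithin_le_nhds)).congr fun z => ?_⟩⟩
  · rw [hc3]
    exact mul_ne_zero hs0 (by norm_num)
  · rw [dupS]; ring
  · rw [hc3, hsp]
    norm_num
  · rw [dupC]; ring

end DixonSystem

/-- Let `(c, s)` be the solution of the IVP on `B_{2r}(0)`,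
`r = 2^(-2/3)`, let `K ∈ (0,2)` be the unique real with `s (-K/2) = -1`, and let
`γ = exp(2πi/3)`. Then there exist holomorphic functions `C, S` on
`U = B_{4r}(0) \ {-K, -Kγ, -K conj γ}` extending `c` and `s`, satisfying
`C' = -S^2`, `S' = C^2` on `U`, and each excluded point is a simple pole of both
`S` and `C`. -/
theorem dixon_extension_4r (r : ℝ) (hr : r = (2:ℝ) ^ (-(2/3) : ℝ))
    (γ : ℂ) (hγ : γ = Complex.exp (2 * Real.pi * Complex.I / 3)) (c s : ℂ → ℂ)
    (hc0 : c 0 = 1) (hs0 : s 0 = 0)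
    (hderiv : ∀ z ∈ Metric.ball (0:ℂ) (2 * r),
      HasDerivAt c (-(s z) ^ 2) z ∧ HasDerivAt s ((c z) ^ 2) z)
    (K : ℝ) (hK : K ∈ Set.Ioo (0:ℝ) 2) (hsK : s (-(K : ℂ) / 2) = -1) :
    ∃ C S : ℂ → ℂ,
      (∀ z ∈ Metric.ball (0:ℂ) (4 * r) \
          ({-(K : ℂ), -(K : ℂ) * γ, -(K : ℂ) * (starRingEnd ℂ) γ} : Set ℂ),
        HasDerivAt C (-(S z) ^ 2) z ∧ HasDerivAt S ((C z) ^ 2) z) ∧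
      (∀ z ∈ Metric.ball (0:ℂ) (2 * r) \
          ({-(K : ℂ), -(K : ℂ) * γ, -(K : ℂ) * (starRingEnd ℂ) γ} : Set ℂ),
        C z = c z ∧ S z = s z) ∧
      (∀ p ∈ ({-(K : ℂ), -(K : ℂ) * γ, -(K : ℂ) * (starRingEnd ℂ) γ} : Set ℂ),
        (∃ L : ℂ, L ≠ 0 ∧
          Tendsto (fun z => (z - p) * S z) (𝓝[≠] p) (𝓝 L)) ∧
        (∃ L : ℂ, L ≠ 0 ∧
          Tendsto (fun z => (z - p) * C z) (𝓝[≠] p) (𝓝 L))) := by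
  obtain rfl : γ = Complex.exp (2 * Real.pi * Complex.I / (3 : ℕ)) := by rw [hγ]; norm_num
  have hprim := Complex.isPrimitiveRoot_exp 3 three_ne_zero
  set γ := Complex.exp (2 * Real.pi * Complex.I / (3 : ℕ))
  have hγ3 : γ ^ 3 = 1 := hprim.pow_eq_one
  have hconj : (starRingEnd ℂ) γ = γ ^ 2 := by
    rw [← Complex.inv_eq_conj (norm_eq_one_of_pow_eq_one hγ3 three_ne_zero)]
    exact inv_eq_of_mul_eq_one_right (by rw [← hγ3]; ring)
  have hr0 : 0 < r := hr ▸ Real.rpow_pos_of_pos two_pos _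
  have hr3 : r ^ 3 = 1 / 4 := by
    rw [hr, ← Real.rpow_natCast, ← Real.rpow_mul two_pos.le]
    norm_num
  have hr1 : 1 / 2 < r := by
    by_contra! hle
    have := pow_le_pow_left₀ hr0.le hle 3
    norm_num [hr3] at this
  have hsys : DixonSystem c s (ball 0 (2 * r)) := hderiv
  have hKmem : -(K : ℂ) / 2 ∈ ball (0 : ℂ) (2 * r) := by
    rw [mem_ball_zero_iff, norm_div, norm_neg, Complex.norm_real, Real.norm_of_nonneg hK.1.le,
      Complex.norm_ofNat]
    linarith [hK.2]
  have hpoles : ∀ p : ℂ, p ∈ ({-(K : ℂ), -(K : ℂ) * γ, -(K : ℂ) * (starRingEnd ℂ) γ} : Set ℂ) ↔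
      ∃ ω : ℂ, ω ^ 3 = 1 ∧ p = ω * -(K : ℂ) := by
    intro p
    simp only [mem_insert_iff, mem_singleton_iff, hconj]
    constructor
    · rintro (rfl | rfl | rfl)
      · exact ⟨1, by simp⟩
      · exact ⟨γ, hγ3, by ring⟩
      · exact ⟨γ ^ 2, by linear_combination (γ ^ 3 + 1) * hγ3, by ring⟩
    · rintro ⟨ω, hω, rfl⟩
      obtain ⟨i, hi, rfl⟩ := hprim.eq_pow_of_pow_eq_one hω
      interval_cases i
      · simp
      · exact Or.inr (Or.inl (by ring))
      · exact Or.inr (Or.inr (by ring))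
  have hmem4 : ∀ z ∈ ball (0 : ℂ) (4 * r), z / 2 ∈ ball (0 : ℂ) (2 * r) := fun z hz => by
    rw [DixonSystem.half_mem_ball]
    convert hz using 2
    ring
  have hden : ∀ z ∈ ball (0 : ℂ) (4 * r) \
      ({-(K : ℂ), -(K : ℂ) * γ, -(K : ℂ) * (starRingEnd ℂ) γ} : Set ℂ),
      DixonSystem.dupDen c s (z / 2) ≠ 0 := by
    rintro z ⟨hz, hzp⟩
    refine mul_ne_zero (hsys.c_ne_zero hc0 hs0 hr3.le _ (hmem4 z hz)) fun h0 => hzp ?_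
    obtain ⟨ω, hω, hzω⟩ := hsys.eq_rotate_of_cube_eq hc0 hs0 hr3.le (hmem4 z hz) hKmem
      (eq_neg_of_add_eq_zero_right h0) (by rw [hsK]; norm_num)
    exact (hpoles z).2 ⟨ω, hω, by linear_combination 2 * hzω⟩
  refine ⟨DixonSystem.dupC c s, DixonSystem.dupS c s, ?_, ?_, ?_⟩
  · exact (hsys.dup (hsys.cube_add_cube hc0 hs0)).mono fun z hz => ⟨hmem4 z hz.1, hden z hz⟩
  · intro z hz
    have := hsys.eq_dup hc0 hs0 hr3.le z hz.1
    exact ⟨this.1.symm, this.2.symm⟩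
  · intro p hp
    obtain ⟨ω, hω, rfl⟩ := (hpoles p).1 hp
    have hrot := (hsys.rotate hs0 hω _ hKmem).2
    rw [← mul_div_assoc] at hrot
    refine DixonSystem.tendsto_pole hsys hc0 hs0 ?_ ?_
    · have hn := norm_eq_one_of_pow_eq_one hω three_ne_zero
      rw [mul_div_assoc, mem_ball_zero_iff, norm_mul, hn, one_mul]
      exact mem_ball_zero_iff.1 hKmem
    · rw [hrot, hsK, mul_pow, hω]
      norm_num
end

section
/- Let (c, s) be holomorphic functions on U = B_{4r}(0) \ {-K, -Kγ, -K·conj(γ)} (with r = 2^(-2/3), γ = exp(2πi/3)) satisfying c' = -s^2, s' = c^2 on U and restricting on B_r(0) to the unique solution of IVP, where K in (0,2) is the unique real with s(-K/2) = -1. Then for every z in the open disc B_{K/2}(K/2) of radius K/2 centred at K/2, one has s(K - z) = c(z) and c(K - z) = s(z). -/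
open Complex Metric Set

/-- A solution of a homogeneous linear system of holomorphic differential equations on a
star-convex set vanishes identically if it vanishes at the centre. -/
theorem linear_system_eq_zero {n : ℕ} {U : Set ℂ} {z₀ : ℂ} (hU : StarConvex ℝ z₀ U)
    {f : Fin n → ℂ → ℂ} {a : Fin n → Fin n → ℂ → ℂ}
    (ha : ∀ i j, ContinuousOn (a i j) U)
    (hf : ∀ i, ∀ z ∈ U, HasDerivAt (f i) (∑ j, a i j z * f j z) z)
    (h0 : ∀ i, f i z₀ = 0) (i : Fin n) {z : ℂ} (hz : z ∈ U) : f i z = 0 := by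
  set p : ℝ → ℂ := fun t ↦ z₀ + (t : ℂ) * (z - z₀) with hp
  have hpU : ∀ t ∈ Icc (0 : ℝ) 1, p t ∈ U := by
    intro t ht
    have h := hU hz (sub_nonneg.2 ht.2) ht.1 (by ring)
    convert h using 1
    simp only [hp, Complex.real_smul]
    push_cast
    ring
  have hpd : ∀ t, HasDerivAt p (z - z₀) t := by
    intro t
    exact (((Complex.ofRealCLM.hasDerivAt (x := t)).mul_const (z - z₀)).const_add z₀).congr_deriv
      (by simp)
  have hpc : Continuous p := by fun_prop
  have hbound : ∀ i j, ∃ k : ℝ, ∀ t ∈ Icc (0 : ℝ) 1, ‖a i j (p t)‖ ≤ k := fun i j ↦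
    isCompact_Icc.exists_bound_of_continuousOn ((ha i j).comp hpc.continuousOn hpU)
  choose k hk using hbound
  have hk0 : ∀ i j, 0 ≤ k i j := fun i j ↦
    (norm_nonneg _).trans (hk i j 0 (by simp))
  set F : ℝ → Fin n → ℂ := fun t i ↦ f i (p t) with hF
  set F' : ℝ → Fin n → ℂ := fun t i ↦ (∑ j, a i j (p t) * f j (p t)) * (z - z₀) with hF'
  have hFd : ∀ t ∈ Icc (0 : ℝ) 1, HasDerivAt F (F' t) t := fun t ht ↦
    hasDerivAt_pi.2 fun i ↦ (hf i _ (hpU t ht)).comp t (hpd t)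
  set M : ℝ := (∑ i, ∑ j, k i j) * ‖z - z₀‖ with hM
  have hFb : ∀ t ∈ Ico (0 : ℝ) 1, ‖F' t‖ ≤ M * ‖F t‖ := by
    intro t ht
    have hsum : 0 ≤ ∑ i, ∑ j, k i j :=
      Finset.sum_nonneg fun i _ ↦ Finset.sum_nonneg fun j _ ↦ hk0 i j
    refine (pi_norm_le_iff_of_nonneg (by positivity)).2 fun i ↦ ?_
    have h1 : ‖∑ j, a i j (p t) * f j (p t)‖ ≤ (∑ j, k i j) * ‖F t‖ := by
      rw [Finset.sum_mul]
      refine norm_sum_le_of_le _ fun j _ ↦ ?_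
      rw [norm_mul]
      exact mul_le_mul (hk i j t (Ico_subset_Icc_self ht)) (norm_le_pi_norm (F t) j)
        (norm_nonneg _) (hk0 i j)
    have h2 : ∑ j, k i j ≤ ∑ i, ∑ j, k i j :=
      Finset.single_le_sum (f := fun i ↦ ∑ j, k i j)
        (fun i _ ↦ Finset.sum_nonneg fun j _ ↦ hk0 i j) (Finset.mem_univ i)
    calc ‖F' t i‖ = ‖∑ j, a i j (p t) * f j (p t)‖ * ‖z - z₀‖ := norm_mul _ _
      _ ≤ ((∑ i, ∑ j, k i j) * ‖F t‖) * ‖z - z₀‖ := by gcongr; exact h1.trans (by gcongr)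
      _ = M * ‖F t‖ := by rw [hM]; ring
  have hzero := eq_zero_of_abs_deriv_le_mul_abs_self_of_eq_zero_right
    (fun t ht ↦ (hFd t ht).continuousAt.continuousWithinAt)
    (fun t ht ↦ (hFd t (Ico_subset_Icc_self ht)).hasDerivWithinAt)
    (by ext i; simp [hF, hp, h0]) hFb 1 (by simp)
  simpa [hF, hp] using congrFun hzero i

/-- Two solutions of `c' = -s²`, `s' = c²` on a star-convex set agree if they agree at the
centre. -/
theorem dixon_system_unique_s14 {U : Set ℂ} {z₀ : ℂ} (hU : StarConvex ℝ z₀ U)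
    {c s C S : ℂ → ℂ}
    (hc : ∀ z ∈ U, HasDerivAt c (-(s z) ^ 2) z) (hs : ∀ z ∈ U, HasDerivAt s ((c z) ^ 2) z)
    (hC : ∀ z ∈ U, HasDerivAt C (-(S z) ^ 2) z) (hS : ∀ z ∈ U, HasDerivAt S ((C z) ^ 2) z)
    (hc0 : C z₀ = c z₀) (hs0 : S z₀ = s z₀) {z : ℂ} (hz : z ∈ U) :
    C z = c z ∧ S z = s z := by
  have cc : ContinuousOn c U := fun z hz ↦ (hc z hz).continuousAt.continuousWithinAt
  have cs : ContinuousOn s U := fun z hz ↦ (hs z hz).continuousAt.continuousWithinAt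
  have cC : ContinuousOn C U := fun z hz ↦ (hC z hz).continuousAt.continuousWithinAt
  have cS : ContinuousOn S U := fun z hz ↦ (hS z hz).continuousAt.continuousWithinAt
  have key := linear_system_eq_zero hU (f := ![fun z ↦ C z - c z, fun z ↦ S z - s z])
    (a := ![![fun _ ↦ 0, fun z ↦ -(S z + s z)], ![fun z ↦ C z + c z, fun _ ↦ 0]])
    (by
      simp only [Fin.forall_fin_two, Matrix.cons_val_zero, Matrix.cons_val_one]
      exact ⟨⟨continuousOn_const, (cS.add cs).neg⟩, cC.add cc, continuousOn_const⟩)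
    (by
      simp only [Fin.forall_fin_two, Matrix.cons_val_zero, Matrix.cons_val_one,
        Fin.sum_univ_two]
      exact ⟨fun z hz ↦ ((hC z hz).sub (hc z hz)).congr_deriv (by ring),
        fun z hz ↦ ((hS z hz).sub (hs z hz)).congr_deriv (by ring)⟩)
    (by simp [Fin.forall_fin_two, hc0, hs0])
  exact ⟨sub_eq_zero.1 (key 0 hz), sub_eq_zero.1 (key 1 hz)⟩

/-- The first integral `c³ + s³ = 1` of the system `c' = -s²`, `s' = c²`. -/
theorem dixon_cube_add_cube_s14 {U : Set ℂ} (hU : StarConvex ℝ 0 U) {c s : ℂ → ℂ}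
    (hc : ∀ z ∈ U, HasDerivAt c (-(s z) ^ 2) z) (hs : ∀ z ∈ U, HasDerivAt s ((c z) ^ 2) z)
    (hc0 : c 0 = 1) (hs0 : s 0 = 0) {z : ℂ} (hz : z ∈ U) : c z ^ 3 + s z ^ 3 = 1 := by
  have key := linear_system_eq_zero hU (f := fun _ : Fin 1 ↦ fun z ↦ c z ^ 3 + s z ^ 3 - 1)
    (a := fun _ _ _ ↦ 0) (fun _ _ ↦ continuousOn_const)
    (fun _ z hz ↦ ((((hc z hz).pow 3).add ((hs z hz).pow 3)).sub_const 1).congr_deriv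
      (by simp; ring))
    (by simp [hc0, hs0]) 0 hz
  exact sub_eq_zero.1 key

/-- Reflection formulas `c(z) c(-z) = 1` and `s(z) c(-z) = -s(-z)` for the solution of the
initial value problem. -/
theorem dixon_neg {U : Set ℂ} (hU : StarConvex ℝ 0 U) (hneg : ∀ z ∈ U, -z ∈ U)
    {c s : ℂ → ℂ}
    (hc : ∀ z ∈ U, HasDerivAt c (-(s z) ^ 2) z) (hs : ∀ z ∈ U, HasDerivAt s ((c z) ^ 2) z)
    (hc0 : c 0 = 1) (hs0 : s 0 = 0) {z : ℂ} (hz : z ∈ U) :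
    c z * c (-z) = 1 ∧ s z * c (-z) = -s (-z) := by
  have hcn : ∀ z ∈ U, HasDerivAt (fun z ↦ c (-z)) (s (-z) ^ 2) z := fun z hz ↦
    ((hc _ (hneg z hz)).comp z (hasDerivAt_neg z)).congr_deriv (by ring)
  have hsn : ∀ z ∈ U, HasDerivAt (fun z ↦ s (-z)) (-c (-z) ^ 2) z := fun z hz ↦
    ((hs _ (hneg z hz)).comp z (hasDerivAt_neg z)).congr_deriv (by ring)
  have cc : ContinuousOn c U := fun z hz ↦ (hc z hz).continuousAt.continuousWithinAt
  have cs : ContinuousOn s U := fun z hz ↦ (hs z hz).continuousAt.continuousWithinAt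
  have ccn : ContinuousOn (fun z ↦ c (-z)) U := fun z hz ↦
    (hcn z hz).continuousAt.continuousWithinAt
  have csn : ContinuousOn (fun z ↦ s (-z)) U := fun z hz ↦
    (hsn z hz).continuousAt.continuousWithinAt
  have cube := fun z (hz : z ∈ U) ↦ dixon_cube_add_cube_s14 hU hc hs hc0 hs0 hz
  have key := linear_system_eq_zero hU
    (f := ![fun z ↦ c z * c (-z) - 1, fun z ↦ s (-z) * c z + s z,
      fun z ↦ s z * c (-z) + s (-z)])
    (a := ![![fun _ ↦ 0, fun z ↦ s (-z), fun z ↦ -s z],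
      ![fun z ↦ -(c (-z) + c z ^ 2), fun _ ↦ 0, fun z ↦ -s z ^ 2],
      ![fun z ↦ c z + c (-z) ^ 2, fun z ↦ s (-z) ^ 2, fun _ ↦ 0]])
    (by
      simp only [Fin.forall_fin_succ, Fin.isValue, Matrix.cons_val_zero, Matrix.cons_val_succ,
        IsEmpty.forall_iff, and_true]
      exact ⟨⟨continuousOn_const, csn, cs.neg⟩,
        ⟨(ccn.add (cc.pow 2)).neg, continuousOn_const, (cs.pow 2).neg⟩,
        cc.add (ccn.pow 2), csn.pow 2, continuousOn_const⟩)
    (by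
      simp only [Fin.forall_fin_succ, Fin.isValue, Matrix.cons_val_zero, Matrix.cons_val_succ,
        IsEmpty.forall_iff, and_true, Fin.sum_univ_succ, Finset.univ_eq_empty,
        Finset.sum_empty]
      refine ⟨fun z hz ↦ (((hc z hz).mul (hcn z hz)).sub_const 1).congr_deriv (by ring),
        fun z hz ↦ (((hsn z hz).mul (hc z hz)).add (hs z hz)).congr_deriv ?_,
        fun z hz ↦ (((hs z hz).mul (hcn z hz)).add (hsn z hz)).congr_deriv ?_⟩
      · linear_combination c (-z) * cube z hz
      · linear_combination (-c z) * cube (-z) (hneg z hz))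
    (by simp [Fin.forall_fin_succ, hc0, hs0])
  exact ⟨sub_eq_zero.1 (key 0 hz), eq_neg_of_add_eq_zero_left (key 2 hz)⟩

/-- Let `(c, s)` be holomorphic on
`U = B_{4r}(0) \ {-K, -Kγ, -K conj γ}` (with `r = 2^(-2/3)`, `γ = exp(2πi/3)`),
satisfying `c' = -s^2`, `s' = c^2` on `U` and restricting on `B_r(0)` to the unique
solution of the IVP, where `K ∈ (0,2)` is the unique real with `s (-K/2) = -1`.
Then for every `z` in the disc `B_{K/2}(K/2)`, `s (K - z) = c z` and `c (K - z) = s z`. -/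
theorem dixon_complementarity (r : ℝ) (hr : r = (2:ℝ) ^ (-(2/3) : ℝ))
    (γ : ℂ) (hγ : γ = Complex.exp (2 * Real.pi * Complex.I / 3))
    (K : ℝ) (hK : K ∈ Set.Ioo (0:ℝ) 2) (c s : ℂ → ℂ)
    (hball : Metric.ball (0:ℂ) r ⊆ Metric.ball (0:ℂ) (4 * r) \
      ({-(K : ℂ), -(K : ℂ) * γ, -(K : ℂ) * (starRingEnd ℂ) γ} : Set ℂ))
    (hc0 : c 0 = 1) (hs0 : s 0 = 0)
    (hderiv : ∀ z ∈ Metric.ball (0:ℂ) (4 * r) \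
        ({-(K : ℂ), -(K : ℂ) * γ, -(K : ℂ) * (starRingEnd ℂ) γ} : Set ℂ),
      HasDerivAt c (-(s z) ^ 2) z ∧ HasDerivAt s ((c z) ^ 2) z)
    (hsK : s (-(K : ℂ) / 2) = -1) :
    ∀ z ∈ Metric.ball ((K : ℂ) / 2) (K / 2),
      s ((K : ℂ) - z) = c z ∧ c ((K : ℂ) - z) = s z := by
  obtain ⟨hK0, hK2⟩ := hK
  have hr2 : 1 / 2 ≤ r := by
    rw [hr, show (1 / 2 : ℝ) = 2 ^ (-1 : ℝ) by rw [Real.rpow_neg_one]; norm_num]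
    exact Real.rpow_le_rpow_of_exponent_le (by norm_num) (by norm_num)
  have hγ1 : ‖γ‖ = 1 := by
    rw [hγ, show 2 * (Real.pi : ℂ) * Complex.I / 3 = ((2 * Real.pi / 3 : ℝ) : ℂ) * Complex.I by
      push_cast; ring]
    exact Complex.norm_exp_ofReal_mul_I _
  have hsub : ∀ z ∈ Metric.ball (0 : ℂ) K, z ∈ Metric.ball (0 : ℂ) (4 * r) \
      ({-(K : ℂ), -(K : ℂ) * γ, -(K : ℂ) * (starRingEnd ℂ) γ} : Set ℂ) := by
    intro z hz
    rw [mem_ball_zero_iff] at hz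
    refine ⟨by rw [mem_ball_zero_iff]; linarith, fun h ↦ hz.ne ?_⟩
    rcases h with rfl | rfl | rfl <;> simp [hγ1, abs_of_pos hK0]
  have hc := fun z hz ↦ (hderiv z (hsub z hz)).1
  have hs := fun z hz ↦ (hderiv z (hsub z hz)).2
  have hmid : (K : ℂ) / 2 ∈ Metric.ball (0 : ℂ) K := by
    rw [mem_ball_zero_iff]
    simp [abs_of_pos hK0, hK0]
  obtain ⟨h1, h2⟩ := dixon_neg ((convex_ball (0 : ℂ) K).starConvex (mem_ball_self hK0))
    (fun z hz ↦ by simpa using hz) hc hs hc0 hs0 hmid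
  rw [← neg_div, hsK, neg_neg] at h2
  rw [← neg_div] at h1
  have hne : c (-(K : ℂ) / 2) ≠ 0 := right_ne_zero_of_mul_eq_one h1
  have heq : s ((K : ℂ) / 2) = c ((K : ℂ) / 2) := mul_right_cancel₀ hne (h2.trans h1.symm)
  have hball' : ∀ z ∈ Metric.ball ((K : ℂ) / 2) (K / 2), z ∈ Metric.ball (0 : ℂ) K := by
    refine fun z hz ↦ ball_subset_ball' ?_ hz
    simp [abs_of_pos hK0]
  have hrefl : ∀ z ∈ Metric.ball ((K : ℂ) / 2) (K / 2),
      (K : ℂ) - z ∈ Metric.ball (0 : ℂ) K := by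
    intro z hz
    apply hball'
    rw [mem_ball_iff_norm, ← norm_neg] at hz ⊢
    rw [norm_neg] at hz
    convert hz using 2
    ring
  intro z hz
  refine dixon_system_unique_s14 (C := fun z ↦ s (K - z)) (S := fun z ↦ c (K - z))
    ((convex_ball ((K : ℂ) / 2) (K / 2)).starConvex (mem_ball_self (by positivity)))
    (fun w hw ↦ hc w (hball' w hw)) (fun w hw ↦ hs w (hball' w hw))
    (fun w hw ↦ ?_) (fun w hw ↦ ?_) ?_ ?_ hz
  · exact ((hs _ (hrefl w hw)).comp w ((hasDerivAt_id w).const_sub (K : ℂ))).congr_deriv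
      (by ring)
  · exact ((hc _ (hrefl w hw)).comp w ((hasDerivAt_id w).const_sub (K : ℂ))).congr_deriv
      (by ring)
  · simp [sub_half, heq]
  · simp [sub_half, heq]
end

section
/- Let (c, s) solve the initial value problem IVP on the open disc B_r(0) with r = 2^(-2/3). Then the addition formulae hold in cross-multiplied form: for all a, z in B_r(0) with a + z in B_r(0), c(a+z) · (s(a)·c(a)·s(z)^2 + c(z)) = c(a)·c(z)^2 - s(a)^2·s(z) and s(a+z) · (s(a)·c(a)·s(z)^2 + c(z)) = s(a) + c(a)^2·s(z)·c(z). -/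
open Complex Metric Set

/-- Two holomorphic functions with vanishing Wronskian on a preconnected open set are proportional,
as soon as one of them does not vanish at some point. -/
theorem mul_eq_mul_of_wronskian_eq_zero {U : Set ℂ} (hU : IsOpen U) (hUc : IsPreconnected U)
    {f g f' g' : ℂ → ℂ} (hf : ∀ z ∈ U, HasDerivAt f (f' z) z) (hg : ∀ z ∈ U, HasDerivAt g (g' z) z)
    (hW : ∀ z ∈ U, f' z * g z - f z * g' z = 0) {z₀ : ℂ} (hz₀ : z₀ ∈ U) (hg₀ : g z₀ ≠ 0)
    {z : ℂ} (hz : z ∈ U) : f z * g z₀ = f z₀ * g z := by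
  have hnear : ∀ᶠ w in nhds z₀, w ∈ U ∧ g w ≠ 0 :=
    Filter.Eventually.and (hU.mem_nhds hz₀) ((hg z₀ hz₀).continuousAt.eventually_ne hg₀)
  obtain ⟨ε, hε, hball⟩ := Metric.eventually_nhds_iff_ball.1 hnear
  have hquot : ∀ w ∈ ball z₀ ε, HasDerivAt (fun x => f x / g x) 0 w := fun w hw => by
    obtain ⟨hwU, hgw⟩ := hball w hw
    exact ((hf w hwU).div (hg w hwU) hgw).congr_deriv (by rw [hW w hwU, zero_div])
  have hlocal : ∀ w ∈ ball z₀ ε, f w * g z₀ = f z₀ * g w := fun w hw => by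
    have h := isOpen_ball.is_const_of_deriv_eq_zero (convex_ball z₀ ε).isPreconnected
      (fun x hx => (hquot x hx).differentiableAt.differentiableWithinAt)
      (fun x hx => (hquot x hx).deriv) hw (mem_ball_self hε)
    exact (div_eq_div_iff (hball w hw).2 hg₀).1 h
  have hfa : AnalyticOnNhd ℂ (fun w => f w * g z₀) U :=
    DifferentiableOn.analyticOnNhd
      (fun w hw => ((hf w hw).mul_const _).differentiableAt.differentiableWithinAt) hU
  have hga : AnalyticOnNhd ℂ (fun w => f z₀ * g w) U :=
    DifferentiableOn.analyticOnNhd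
      (fun w hw => ((hg w hw).const_mul _).differentiableAt.differentiableWithinAt) hU
  exact hfa.eqOn_of_preconnected_of_eventuallyEq hga hUc hz₀
    (Filter.eventually_of_mem (ball_mem_nhds z₀ hε) hlocal) hz

/-- If `(c, s)` solves the IVP on `B_r(0)`, `r = 2^(-2/3)`, then the
addition formulae hold in cross-multiplied form for all `a, z` in the disc with
`a + z` in the disc. -/
theorem dixon_addition (r : ℝ) (hr : r = (2:ℝ) ^ (-(2/3) : ℝ)) (c s : ℂ → ℂ)
    (hc0 : c 0 = 1) (hs0 : s 0 = 0)
    (hderiv : ∀ z ∈ Metric.ball (0:ℂ) r,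
      HasDerivAt c (-(s z) ^ 2) z ∧ HasDerivAt s ((c z) ^ 2) z) :
    ∀ a ∈ Metric.ball (0:ℂ) r, ∀ z ∈ Metric.ball (0:ℂ) r,
      a + z ∈ Metric.ball (0:ℂ) r →
      c (a + z) * (s a * c a * s z ^ 2 + c z) = c a * c z ^ 2 - s a ^ 2 * s z ∧
      s (a + z) * (s a * c a * s z ^ 2 + c z) = s a + c a ^ 2 * s z * c z := by
  intro a ha z hz haz
  obtain ⟨w, hw⟩ : ∃ w, w = a + z := ⟨_, rfl⟩
  obtain rfl : a = w - z := by rw [hw]; ring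
  rw [← hw] at haz ⊢
  have hmem : ∀ x, w - x ∈ ball (0 : ℂ) r ↔ x ∈ ball w r := fun x => by
    rw [mem_ball_zero_iff, mem_ball', dist_eq_norm]
  have hUo : IsOpen (ball (0 : ℂ) r ∩ ball w r) := isOpen_ball.inter isOpen_ball
  have hUc : IsPreconnected (ball (0 : ℂ) r ∩ ball w r) :=
    ((convex_ball _ _).inter (convex_ball _ _)).isPreconnected
  have h0U : (0 : ℂ) ∈ ball (0 : ℂ) r ∩ ball w r :=
    ⟨mem_ball_self (pos_of_mem_ball hz), (hmem 0).1 (by simpa using haz)⟩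
  have hzU : z ∈ ball (0 : ℂ) r ∩ ball w r := ⟨hz, (hmem z).1 ha⟩
  have hC : ∀ x ∈ ball (0 : ℂ) r ∩ ball w r, HasDerivAt c (-(s x) ^ 2) x :=
    fun x hx => (hderiv x hx.1).1
  have hS : ∀ x ∈ ball (0 : ℂ) r ∩ ball w r, HasDerivAt s ((c x) ^ 2) x :=
    fun x hx => (hderiv x hx.1).2
  have hCw : ∀ x ∈ ball (0 : ℂ) r ∩ ball w r,
      HasDerivAt (fun y => c (w - y)) (s (w - x) ^ 2) x := fun x hx => by
    simpa using (hderiv _ ((hmem x).2 hx.2)).1.comp_const_sub w x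
  have hSw : ∀ x ∈ ball (0 : ℂ) r ∩ ball w r,
      HasDerivAt (fun y => s (w - y)) (-c (w - x) ^ 2) x := fun x hx => by
    simpa using (hderiv _ ((hmem x).2 hx.2)).2.comp_const_sub w x
  have hcube : ∀ x ∈ ball (0 : ℂ) r ∩ ball w r, c x ^ 3 + s x ^ 3 = 1 :=
    fun x hx => cube_add_cube_eq_one hc0 hs0 hderiv hx.1
  have hcubew : ∀ x ∈ ball (0 : ℂ) r ∩ ball w r, c (w - x) ^ 3 + s (w - x) ^ 3 = 1 :=
    fun x hx => cube_add_cube_eq_one hc0 hs0 hderiv ((hmem x).2 hx.2)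
  have hden : ∀ x ∈ ball (0 : ℂ) r ∩ ball w r,
      HasDerivAt (fun y => s (w - y) * c (w - y) * s y ^ 2 + c y)
        (2 * c (w - x) * s x * (s (w - x) * c x ^ 2 - c (w - x) ^ 2 * s x)) x := fun x hx => by
    refine ((((hSw x hx).mul (hCw x hx)).mul ((hS x hx).fun_pow 2)).add (hC x hx)).congr_deriv ?_
    push_cast
    simp only [Pi.mul_apply]
    linear_combination s x ^ 2 * hcubew x hx
  have hnumc : ∀ x ∈ ball (0 : ℂ) r ∩ ball w r,
      HasDerivAt (fun y => c (w - y) * c y ^ 2 - s (w - y) ^ 2 * s y)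
        (2 * c (w - x) * s x * (s (w - x) * c (w - x) - c x * s x)) x := fun x hx => by
    refine (((hCw x hx).mul ((hC x hx).fun_pow 2)).sub
      (((hSw x hx).fun_pow 2).mul (hS x hx))).congr_deriv ?_
    push_cast
    ring
  have hnums : ∀ x ∈ ball (0 : ℂ) r ∩ ball w r,
      HasDerivAt (fun y => s (w - y) + c (w - y) ^ 2 * s y * c y)
        (2 * c (w - x) * s x * (s (w - x) ^ 2 * c x - c (w - x) * s x ^ 2)) x := fun x hx => by
    refine ((hSw x hx).add
      ((((hCw x hx).fun_pow 2).mul (hS x hx)).mul (hC x hx))).congr_deriv ?_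
    push_cast
    simp only [Pi.mul_apply]
    linear_combination c (w - x) ^ 2 * hcube x hx
  have hden0 : s (w - 0) * c (w - 0) * s 0 ^ 2 + c 0 ≠ 0 := by simp [hc0, hs0]
  constructor
  · have h := mul_eq_mul_of_wronskian_eq_zero hUo hUc hnumc hden (fun x hx => by
      linear_combination (-2 * c (w - x) * s x * (s (w - x) * c (w - x) * c x)) * hcube x hx
        + 2 * c (w - x) * s x * (c x ^ 2 * s x) * hcubew x hx) h0U hden0 hzU
    simpa [hc0, hs0] using h.symm
  · have h := mul_eq_mul_of_wronskian_eq_zero hUo hUc hnums hden (fun x hx => by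
      linear_combination 2 * c (w - x) * s x * (c (w - x) * c x * s x ^ 2) * hcubew x hx
        - 2 * c (w - x) * s x * (s (w - x) * c (w - x) ^ 2 * s x) * hcube x hx) h0U hden0 hzU
    simpa [hc0, hs0] using h.symm
end

section
/- Let (c, s) solve the initial value problem IVP on the open disc B_{2r}(0) with r = 2^(-2/3). Then 0 is the only point of B_{2r}(0) at which the value of c is a cube root of unity (if z in B_{2r}(0) satisfies c(z)^3 = 1 then z = 0); consequently, defining p(z) = s(z)/(3·(1 - c(z))) for z in B_r(0) \ {0}, for every such z one has p'(z) = (c(z) + 1)/(3·(c(z) - 1)) and p'(z)^2 = 4·p(z)^3 - 1/27. -/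
open Complex Metric Set

/-- The first integral `f ^ 3 + g ^ 3` of the system `f' = -a g ^ 2`, `g' = a f ^ 2`. -/
theorem cube_add_cube_eq_one_s19 {f g : ℝ → ℂ} {a : ℂ}
    (h0 : f 0 ^ 3 + g 0 ^ 3 = 1)
    (hf : ∀ t ∈ Icc (0:ℝ) 1, HasDerivAt f (-a * g t ^ 2) t)
    (hg : ∀ t ∈ Icc (0:ℝ) 1, HasDerivAt g (a * f t ^ 2) t) :
    ∀ t ∈ Icc (0:ℝ) 1, f t ^ 3 + g t ^ 3 = 1 := by
  have hd : ∀ t ∈ Icc (0:ℝ) 1, HasDerivAt (fun t => f t ^ 3 + g t ^ 3) 0 t := by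
    intro t ht
    refine (((hf t ht).pow 3).add ((hg t ht).pow 3)).congr_deriv ?_
    push_cast
    ring
  intro t ht
  rw [← h0]
  exact constant_of_has_deriv_right_zero (fun x hx => (hd x hx).continuousAt.continuousWithinAt)
    (fun x hx => (hd x (Ico_subset_Icc_self hx)).hasDerivWithinAt) t ht

theorem norm_le_self_of_system {f g : ℝ → ℂ} {a : ℂ} {r : ℝ} (hr0 : 0 < r) (hr3 : r ^ 3 = 1 / 4)
    (ha0 : a ≠ 0) (ha : ‖a‖ < r) (hf0 : f 0 ^ 3 = 1) (hg0 : g 0 = 0)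
    (hf : ∀ t ∈ Icc (0:ℝ) 1, HasDerivAt f (-a * g t ^ 2) t)
    (hg : ∀ t ∈ Icc (0:ℝ) 1, HasDerivAt g (a * f t ^ 2) t) :
    ∀ t ∈ Icc (0:ℝ) 1, ‖g t‖ ≤ t := by
  have hc := cube_add_cube_eq_one_s19 (by rw [hf0, hg0]; norm_num) hf hg
  have hpos : 0 < ‖a‖ := norm_pos_iff.mpr ha0
  have key : ∀ t ∈ Icc (0:ℝ) 1, ‖g t‖ ≤ ‖a‖ / r * t := by
    intro t ht
    refine image_norm_le_of_norm_deriv_right_lt_deriv_boundary (B := fun t => ‖a‖ / r * t)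
      (B' := fun _ => ‖a‖ / r)
      (fun x hx => (hg x hx).continuousAt.continuousWithinAt)
      (fun x hx => (hg x (Ico_subset_Icc_self hx)).hasDerivWithinAt) (by simp [hg0])
      (fun x => by simpa using (hasDerivAt_id x).const_mul (‖a‖ / r)) ?_ ht
    intro x hx hgx
    have hx1 : ‖g x‖ < 1 := by
      rw [hgx]
      have : ‖a‖ / r < 1 := (div_lt_one hr0).mpr ha
      have : 0 < ‖a‖ / r := by positivity
      nlinarith [hx.1, hx.2]
    have hfx : ‖f x‖ ^ 3 < 2 := by
      have h1 : f x ^ 3 = 1 - g x ^ 3 := by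
        linear_combination hc x (Ico_subset_Icc_self hx)
      have h2 : ‖g x‖ ^ 3 < 1 := pow_lt_one₀ (norm_nonneg _) hx1 (by norm_num)
      calc ‖f x‖ ^ 3 = ‖1 - g x ^ 3‖ := by rw [← norm_pow, h1]
        _ ≤ ‖(1:ℂ)‖ + ‖g x ^ 3‖ := norm_sub_le _ _
        _ < 2 := by rw [norm_one, norm_pow]; linarith
    have hlt : ‖f x‖ ^ 2 < 1 / r := by
      refine lt_of_pow_lt_pow_left₀ 3 (by positivity) ?_
      rw [one_div, inv_pow, hr3]
      have : 0 ≤ ‖f x‖ ^ 3 := by positivity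
      calc (‖f x‖ ^ 2) ^ 3 = ‖f x‖ ^ 3 * ‖f x‖ ^ 3 := by ring
        _ < (1 / 4)⁻¹ := by norm_num; nlinarith
    rw [norm_mul, norm_pow, div_eq_mul_one_div]
    exact mul_lt_mul_of_pos_left hlt hpos
  intro t ht
  refine (key t ht).trans ?_
  have : ‖a‖ / r ≤ 1 := (div_le_one hr0).mpr ha.le
  nlinarith [ht.1]

theorem norm_sub_initial_of_system {f g : ℝ → ℂ} {a : ℂ} {r : ℝ} (hr0 : 0 < r)
    (hr3 : r ^ 3 = 1 / 4)
    (ha0 : a ≠ 0) (ha : ‖a‖ < r) (hf0 : f 0 ^ 3 = 1) (hg0 : g 0 = 0)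
    (hf : ∀ t ∈ Icc (0:ℝ) 1, HasDerivAt f (-a * g t ^ 2) t)
    (hg : ∀ t ∈ Icc (0:ℝ) 1, HasDerivAt g (a * f t ^ 2) t) :
    ‖f 1 - f 0‖ ≤ 2 / 9 ∧ ‖g 1 - a * f 0 ^ 2‖ < ‖a‖ := by
  have hgt := norm_le_self_of_system hr0 hr3 ha0 ha hf0 hg0 hf hg
  have hpos : 0 < ‖a‖ := norm_pos_iff.mpr ha0
  have ha' : ‖a‖ < 2 / 3 := by
    refine ha.trans (lt_of_pow_lt_pow_left₀ 3 (by norm_num) ?_)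
    rw [hr3]; norm_num
  have hF : ∀ t ∈ Icc (0:ℝ) 1, ‖f t - f 0‖ ≤ 2 / 9 * t ^ 3 := by
    intro t ht
    refine image_norm_le_of_norm_deriv_right_le_deriv_boundary (f := fun t => f t - f 0)
      (B := fun t => 2 / 9 * t ^ 3) (B' := fun t => 2 / 3 * t ^ 2)
      (fun x hx => ((hf x hx).sub_const (f 0)).continuousAt.continuousWithinAt)
      (fun x hx => ((hf x (Ico_subset_Icc_self hx)).sub_const (f 0)).hasDerivWithinAt)
      (by simp) (fun x => ?_) ?_ ht
    · refine ((hasDerivAt_pow 3 x).const_mul (2 / 9 : ℝ)).congr_deriv ?_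
      norm_num; ring
    · intro x hx
      rw [norm_mul, norm_neg, norm_pow]
      have := hgt x (Ico_subset_Icc_self hx)
      gcongr
  have hF' : ∀ t ∈ Icc (0:ℝ) 1, ‖f t - f 0‖ ≤ 2 / 9 := fun t ht =>
    (hF t ht).trans (by have := pow_le_one₀ ht.1 ht.2 (n := 3); linarith)
  refine ⟨hF' 1 (by simp), ?_⟩
  have hn : ‖f 0‖ = 1 := by
    rw [← pow_eq_one_iff_of_nonneg (norm_nonneg _) (three_ne_zero), ← norm_pow, hf0, norm_one]
  have hd : ∀ t ∈ Icc (0:ℝ) 1,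
      HasDerivAt (fun t : ℝ => g t - t * (a * f 0 ^ 2)) (a * f t ^ 2 - a * f 0 ^ 2) t := by
    intro t ht
    refine ((hg t ht).sub
      ((ofRealCLM.hasDerivAt (x := t)).mul_const (a * f 0 ^ 2))).congr_deriv ?_
    simp
  have hG := norm_image_sub_le_of_norm_deriv_le_segment_01' (C := ‖a‖ * (1 / 2))
    (fun x hx => (hd x hx).hasDerivWithinAt) (by
      intro x hx
      have h1 := hF' x (Ico_subset_Icc_self hx)
      have h2 : ‖f x + f 0‖ ≤ 20 / 9 := by
        calc ‖f x + f 0‖ = ‖(f x - f 0) + 2 * f 0‖ := by ring_nf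
          _ ≤ ‖f x - f 0‖ + ‖2 * f 0‖ := norm_add_le _ _
          _ ≤ 20 / 9 := by rw [norm_mul, hn]; norm_num; linarith
      rw [show a * f x ^ 2 - a * f 0 ^ 2 = a * ((f x - f 0) * (f x + f 0)) by ring,
        norm_mul, norm_mul]
      refine mul_le_mul_of_nonneg_left ?_ hpos.le
      calc ‖f x - f 0‖ * ‖f x + f 0‖ ≤ 2 / 9 * (20 / 9) := by gcongr
        _ ≤ 1 / 2 := by norm_num)
  simp only [ofReal_one, one_mul, ofReal_zero, zero_mul, sub_zero, hg0] at hG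
  linarith

theorem eq_one_of_cube_eq_one_of_norm_sub_lt {w : ℂ} (hw : w ^ 3 = 1) (h : ‖w - 1‖ < 1) :
    w = 1 := by
  by_contra hne
  have h1 : w ^ 2 + w + 1 = 0 :=
    mul_left_cancel₀ (sub_ne_zero.mpr hne) (by linear_combination hw)
  have hn : ‖w‖ = 1 := by
    rw [← pow_eq_one_iff_of_nonneg (norm_nonneg _) (three_ne_zero), ← norm_pow, hw, norm_one]
  have h2 : ‖w - 1‖ ^ 2 = 3 := by
    rw [← norm_pow, show (w - 1) ^ 2 = -3 * w by linear_combination h1, norm_mul, hn]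
    norm_num
  nlinarith [norm_nonneg (w - 1)]

/-- If `(c, s)` solves the IVP on `B_{2r}(0)`, `r = 2^(-2/3)`, then
`0` is the only point of `B_{2r}(0)` where `c` takes a cube-root-of-unity value;
consequently the function `p = s / (3(1 - c))` on `B_r(0) \ {0}` satisfies
`p' = (c + 1)/(3(c - 1))` and `(p')^2 = 4 p^3 - 1/27`. -/
theorem dixon_weierstrass (r : ℝ) (hr : r = (2:ℝ) ^ (-(2/3) : ℝ)) (c s : ℂ → ℂ)
    (hc0 : c 0 = 1) (hs0 : s 0 = 0)
    (hderiv : ∀ z ∈ Metric.ball (0:ℂ) (2 * r),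
      HasDerivAt c (-(s z) ^ 2) z ∧ HasDerivAt s ((c z) ^ 2) z) :
    (∀ z ∈ Metric.ball (0:ℂ) (2 * r), c z ^ 3 = 1 → z = 0) ∧
    ∀ z ∈ Metric.ball (0:ℂ) r \ ({0} : Set ℂ),
      HasDerivAt (fun w => s w / (3 * (1 - c w))) ((c z + 1) / (3 * (c z - 1))) z ∧
      ((c z + 1) / (3 * (c z - 1))) ^ 2 = 4 * (s z / (3 * (1 - c z))) ^ 3 - 1 / 27 := by
  have hr0 : 0 < r := by rw [hr]; positivity
  have hr3 : r ^ 3 = 1 / 4 := by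
    rw [hr, ← Real.rpow_natCast, ← Real.rpow_mul (by norm_num)]
    norm_num
  have hline : ∀ b a : ℂ, (∀ t ∈ Icc (0:ℝ) 1, b + t * a ∈ ball (0:ℂ) (2 * r)) →
      (∀ t ∈ Icc (0:ℝ) 1,
        HasDerivAt (fun t : ℝ => c (b + t * a)) (-a * s (b + t * a) ^ 2) t) ∧
      ∀ t ∈ Icc (0:ℝ) 1,
        HasDerivAt (fun t : ℝ => s (b + t * a)) (a * c (b + t * a) ^ 2) t := by
    intro b a h
    have hl : ∀ t : ℝ, HasDerivAt (fun t : ℝ => b + t * a) a t := fun t => by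
      simpa using ((ofRealCLM.hasDerivAt (x := t)).mul_const a).const_add b
    refine ⟨fun t ht => ?_, fun t ht => ?_⟩
    · refine ((hderiv _ (h t ht)).1.comp t (hl t)).congr_deriv ?_
      ring
    · refine ((hderiv _ (h t ht)).2.comp t (hl t)).congr_deriv ?_
      ring
  have hcs : ∀ z ∈ ball (0:ℂ) (2 * r), c z ^ 3 + s z ^ 3 = 1 := by
    intro z hz
    obtain ⟨h1, h2⟩ := hline 0 z (fun t ht => by
      rw [mem_ball_zero_iff] at hz ⊢
      rw [zero_add, norm_mul, norm_real, Real.norm_of_nonneg ht.1]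
      nlinarith [ht.2, norm_nonneg z])
    simpa using cube_add_cube_eq_one_s19 (by simp [hc0, hs0]) h1 h2 1 (by simp)
  have hroot : ∀ z ∈ ball (0:ℂ) (2 * r), c z ^ 3 = 1 → z = 0 := by
    intro z hz hcz
    by_contra hz0
    have hsz : s z = 0 := by
      have := hcs z hz
      rw [hcz] at this
      exact pow_eq_zero_iff (three_ne_zero) |>.mp (by linear_combination this)
    rw [mem_ball_zero_iff] at hz
    have hn : ‖z / 2‖ < r := by rw [norm_div]; norm_num; linarith
    have hmem : ∀ t ∈ Icc (0:ℝ) 1, ((t:ℂ) * z) ∈ ball (0:ℂ) (2 * r) := fun t ht => by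
      rw [mem_ball_zero_iff, norm_mul, norm_real, Real.norm_of_nonneg ht.1]
      nlinarith [ht.2, norm_nonneg z]
    obtain ⟨h1, h2⟩ := hline 0 (z / 2) (fun t ht => by
      convert hmem (t / 2) ⟨by linarith [ht.1], by linarith [ht.2]⟩ using 1
      push_cast; ring)
    obtain ⟨h3, h4⟩ := hline z (-(z / 2)) (fun t ht => by
      convert hmem (1 - t / 2) ⟨by linarith [ht.2], by linarith [ht.1]⟩ using 1
      push_cast; ring)
    obtain ⟨hA, hB⟩ := norm_sub_initial_of_system hr0 hr3 (div_ne_zero hz0 two_ne_zero) hn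
      (by simp [hc0]) (by simp [hs0]) h1 h2
    obtain ⟨hC, hD⟩ := norm_sub_initial_of_system hr0 hr3
      (neg_ne_zero.mpr (div_ne_zero hz0 two_ne_zero)) (by rwa [norm_neg])
      (by simpa using hcz) (by simpa using hsz) h3 h4
    have hmid : z + -(z / 2) = z / 2 := by ring
    simp only [ofReal_one, ofReal_zero, one_mul, zero_mul, zero_add, add_zero, hmid, hc0,
      norm_neg] at hA hB hC hD
    have hcz1 : c z = 1 := by
      refine eq_one_of_cube_eq_one_of_norm_sub_lt hcz ?_
      calc ‖c z - 1‖ = ‖(c (z / 2) - 1) - (c (z / 2) - c z)‖ := by ring_nf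
        _ ≤ ‖c (z / 2) - 1‖ + ‖c (z / 2) - c z‖ := norm_sub_le _ _
        _ < 1 := by linarith
    rw [hcz1] at hD
    have h5 := norm_sub_le (s (z / 2) - -(z / 2) * 1 ^ 2) (s (z / 2) - z / 2 * 1 ^ 2)
    rw [show s (z / 2) - -(z / 2) * 1 ^ 2 - (s (z / 2) - z / 2 * 1 ^ 2) = 2 * (z / 2) by ring,
      norm_mul, Complex.norm_ofNat] at h5
    linarith
  refine ⟨hroot, ?_⟩
  rintro z ⟨hz, hz0⟩
  have hz2 : z ∈ ball (0:ℂ) (2 * r) := ball_subset_ball (by linarith) hz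
  have hne : c z - 1 ≠ 0 := fun h =>
    hz0 (hroot z hz2 (by rw [sub_eq_zero.mp h, one_pow]))
  have hne' : 1 - c z ≠ 0 := fun h => hne (by linear_combination -h)
  have h3 : s z ^ 3 = 1 - c z ^ 3 := by linear_combination hcs z hz2
  obtain ⟨hc, hs⟩ := hderiv z hz2
  constructor
  · refine (hs.div ((hc.const_sub 1).const_mul 3)
      (mul_ne_zero three_ne_zero hne')).congr_deriv ?_
    rw [div_eq_div_iff (pow_ne_zero 2 (mul_ne_zero three_ne_zero hne'))
      (mul_ne_zero three_ne_zero hne)]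
    linear_combination (-9 * (c z - 1)) * h3
  · rw [div_pow, div_pow, mul_pow 3 (1 - c z), h3, show 1 - c z = -(c z - 1) by ring]
    field_simp
    ring
end
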